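/- Let NA^s(𝒫) and efficient friction hold for the original market with solvency cones (K_t). Then NA^s(𝒫) and efficient friction also hold for the modified market with solvency cones (K̃_t) obtained from the backward recursion; in particular int K̃*_t ≠ ∅ 𝒫-q.s. for all t. -/

import Mathlib

open MeasureTheory Set
open scoped ENNReal Pointwise

noncomputable section

/-- The universal completion of the σ-algebra on `α`. -/
def univComp (α : Type*) [MeasurableSpace α] : MeasurableSpace α where
  MeasurableSet' s := ∀ μ : Measure α, IsProbabilityMeasure μ → NullMeasurableSet s μ
  measurableSet_empty := fun _ _ => MeasurableSet.empty.nullMeasurableSet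
  measurableSet_compl := fun _ hs μ hμ => (hs μ hμ).compl
  measurableSet_iUnion := fun _ hf μ hμ => NullMeasurableSet.iUnion fun i => hf i μ hμ

/-- A universally measurable set. -/
def UnivMeasurableSet {α : Type*} [MeasurableSpace α] (s : Set α) : Prop :=
  MeasurableSet[univComp α] s

/-- A universally measurable function. -/
def UnivMeasurable {α β : Type*} [MeasurableSpace α] [MeasurableSpace β] (f : α → β) : Prop :=
  Measurable[univComp α] f

/-- Convexity for a set of probability measures. -/
def ConvexProb {α : Type*} [MeasurableSpace α] (𝒬 : Set (ProbabilityMeasure α)) : Prop :=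
  ∀ P ∈ 𝒬, ∀ Q ∈ 𝒬, ∀ a b : ℝ≥0∞, a + b = 1 → ∀ R : ProbabilityMeasure α,
    (R : Measure α) = a • (P : Measure α) + b • (Q : Measure α) → R ∈ 𝒬

/-- The product measure `P₀ ⊗ ⋯ ⊗ P_{T-1}` of a family of one-step kernels. -/
def prodMeas {Ω₁ : Type*} [MeasurableSpace Ω₁]
    (P : (t : ℕ) → (Fin t → Ω₁) → Measure Ω₁) : (T : ℕ) → Measure (Fin T → Ω₁)
  | 0 => Measure.dirac (fun i => i.elim0)
  | T + 1 => (prodMeas P T).bind fun ω => (P T ω).map (Fin.snoc ω)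

/-- The set `𝒫` of all products of universally measurable selectors of the `𝒫ₜ`. -/
def ProdSet {Ω₁ : Type*} [MeasurableSpace Ω₁]
    (𝒬 : (t : ℕ) → (Fin t → Ω₁) → Set (ProbabilityMeasure Ω₁)) (T : ℕ) :
    Set (Measure (Fin T → Ω₁)) :=
  {μ | ∃ P : (t : ℕ) → (Fin t → Ω₁) → ProbabilityMeasure Ω₁,
      (∀ t, t < T → UnivMeasurable (fun ω => (P t ω : Measure Ω₁)) ∧ ∀ ω, P t ω ∈ 𝒬 t ω) ∧
      μ = prodMeas (fun t ω => (P t ω : Measure Ω₁)) T}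

/-- Projection onto the first `t` coordinates. -/
def proj {Ω₁ : Type*} (T t : ℕ) (ht : t ≤ T) (ω : Fin T → Ω₁) : Fin t → Ω₁ :=
  fun i => ω (Fin.castLE ht i)

/-- The σ-algebra `𝓕ₜ` on `Ω = Ω₁^T`: the pullback under the projection onto the first `t`
coordinates of the universal completion of the Borel σ-algebra of `Ω₁^t`. -/
def filt {Ω₁ : Type*} [MeasurableSpace Ω₁] (T t : ℕ) (ht : t ≤ T) :
    MeasurableSpace (Fin T → Ω₁) :=
  MeasurableSpace.comap (proj T t ht) (univComp (Fin t → Ω₁))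

/-- The dual cone of a set in `ℝ^d`. -/
def dualCone {d : ℕ} (C : Set (Fin d → ℝ)) : Set (Fin d → ℝ) :=
  {y | ∀ x ∈ C, 0 ≤ ∑ i, x i * y i}

/-- `f ∈ Aₜ`: attainable claims at time `t` from zero endowment, i.e. `f = ξ₀ + ⋯ + ξₜ`
with each `ξₛ` an `𝓕ₛ`-measurable function with values in `−Cₛ`. -/
def Attainable {Ω₁ : Type*} [MeasurableSpace Ω₁] {d : ℕ}
    (C : (s : ℕ) → (Fin s → Ω₁) → Set (Fin d → ℝ)) (t : ℕ)
    (f : (Fin t → Ω₁) → Fin d → ℝ) : Prop :=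
  ∃ ξ : ℕ → (Fin t → Ω₁) → Fin d → ℝ,
    (∀ s, ∀ hs : s ≤ t, ∃ g : (Fin s → Ω₁) → Fin d → ℝ, UnivMeasurable g ∧
      (∀ ωs, g ωs ∈ -C s ωs) ∧ ∀ ω, ξ s ω = g fun i => ω (Fin.castLE hs i)) ∧
    ∀ ω, f ω = ∑ s ∈ Finset.range (t + 1), ξ s ω

/-- Strict no-arbitrage `NAˢ(𝒫)` for the market with solvency cones `C`:
`Aₜ ∩ L⁰_𝒫(Cₜ; 𝓕ₜ) ⊆ L⁰_𝒫(C⁰ₜ; 𝓕ₜ)` for all `t ∈ {0, …, T}`. -/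
def StrictNoArbitrage {Ω₁ : Type*} [MeasurableSpace Ω₁] {d : ℕ}
    (𝒬 : (t : ℕ) → (Fin t → Ω₁) → Set (ProbabilityMeasure Ω₁))
    (C : (s : ℕ) → (Fin s → Ω₁) → Set (Fin d → ℝ)) (T : ℕ) : Prop :=
  ∀ t, t ≤ T → ∀ f : (Fin t → Ω₁) → Fin d → ℝ, Attainable C t f → UnivMeasurable f →
    (∀ μ ∈ ProdSet 𝒬 t, ∀ᵐ ω ∂μ, f ω ∈ C t ω) →
    (∀ μ ∈ ProdSet 𝒬 t, ∀ᵐ ω ∂μ, f ω ∈ C t ω ∩ -C t ω)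

/-- Efficient friction: `int C*ₜ ≠ ∅` `𝒫`-q.s. for all `t`. -/
def EfficientFriction {Ω₁ : Type*} [MeasurableSpace Ω₁] {d : ℕ}
    (𝒬 : (t : ℕ) → (Fin t → Ω₁) → Set (ProbabilityMeasure Ω₁))
    (C : (s : ℕ) → (Fin s → Ω₁) → Set (Fin d → ℝ)) (T : ℕ) : Prop :=
  ∀ t, t ≤ T → ∀ μ ∈ ProdSet 𝒬 t, ∀ᵐ ω ∂μ, (interior (dualCone (C t ω))).Nonempty

/-- `NA₂(𝒫)`: `L⁰_𝒫(Cₜ₊₁; 𝓕ₜ) ⊆ L⁰_𝒫(Cₜ; 𝓕ₜ)` for all `t`. -/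
def NoArbitrage2 {Ω₁ : Type*} [MeasurableSpace Ω₁] {d : ℕ}
    (𝒬 : (t : ℕ) → (Fin t → Ω₁) → Set (ProbabilityMeasure Ω₁))
    (C : (s : ℕ) → (Fin s → Ω₁) → Set (Fin d → ℝ)) (T : ℕ) : Prop :=
  ∀ t, t < T → ∀ f : (Fin t → Ω₁) → Fin d → ℝ, UnivMeasurable f →
    (∀ μ ∈ ProdSet 𝒬 (t + 1), ∀ᵐ ω ∂μ, f (Fin.init ω) ∈ C (t + 1) ω) →
    (∀ μ ∈ ProdSet 𝒬 t, ∀ᵐ ω ∂μ, f ω ∈ C t ω)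

/-- The support of a set-valued map under a family of probability measures: the smallest closed
set `F ⊆ ℝ^d` such that `P(C(·) ⊆ F) = 1` for every member `P` of the family. -/
def svSupport {α : Type*} [MeasurableSpace α] {d : ℕ} (𝒬 : Set (ProbabilityMeasure α))
    (C : α → Set (Fin d → ℝ)) : Set (Fin d → ℝ) :=
  ⋂₀ {F : Set (Fin d → ℝ) | IsClosed F ∧ ∀ P ∈ 𝒬, (P : Measure α) {x | C x ⊆ F} = 1}

section

open Filter Topology ProbabilityTheory

/-- Sequences whose first `k` terms are bounded by the corresponding terms of `s`. -/
def boundedPrefix (s : ℕ → ℕ) (k : ℕ) : Set (ℕ → ℕ) := {x | ∀ i < k, x i ≤ s i}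

lemma exists_boundedPrefix_measure_gt {X : Type*} [MeasurableSpace X] (ν : Measure X)
    (f : (ℕ → ℕ) → X) {r : ℝ≥0∞} (hr : r < ν (range f)) :
    ∃ s, ∀ k, r < ν (f '' boundedPrefix s k) := by
  have step : ∀ (D : Set (ℕ → ℕ)) (k : ℕ), r < ν (f '' D) →
      ∃ n, r < ν (f '' (D ∩ {x | x k ≤ n})) := by
    intro D k hD
    have hU : f '' D = ⋃ n, f '' (D ∩ {x | x k ≤ n}) := by
      rw [← image_iUnion, ← inter_iUnion]
      congr 1
      ext x
      simp only [mem_inter_iff, mem_iUnion, mem_ofPred_eq]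
      exact ⟨fun h => ⟨h, x k, le_rfl⟩, fun h => h.1⟩
    have hm : Monotone fun n => f '' (D ∩ {x | x k ≤ n}) := by
      intro a b hab
      exact image_mono (inter_subset_inter_right _ fun x hx => le_trans hx hab)
    rw [hU, hm.measure_iUnion] at hD
    exact lt_iSup_iff.1 hD
  choose! N hN using step
  let D : ℕ → Set (ℕ → ℕ) := fun k => Nat.rec univ (fun k D => D ∩ {x | x k ≤ N D k}) k
  have hD0 : D 0 = univ := rfl
  have hDs : ∀ k, D (k + 1) = D k ∩ {x | x k ≤ N (D k) k} := fun k => rfl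
  have hD : ∀ k, r < ν (f '' D k) := by
    intro k
    induction k with
    | zero => rw [hD0, image_univ]; exact hr
    | succ k ih => rw [hDs]; exact hN _ _ ih
  refine ⟨fun k => N (D k) k, fun k => ?_⟩
  have hmem : ∀ k x, x ∈ D k ↔ ∀ i < k, x i ≤ N (D i) i := by
    intro k x
    induction k with
    | zero => simp [hD0]
    | succ k ih =>
      rw [hDs, mem_inter_iff, ih]
      simp only [mem_ofPred_eq, Nat.lt_succ_iff_lt_or_eq]
      constructor
      · rintro ⟨h1, h2⟩ i (hi | rfl)
        · exact h1 i hi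
        · exact h2
      · exact fun h => ⟨fun i hi => h i (Or.inl hi), h k (Or.inr rfl)⟩
  rw [show boundedPrefix (fun k => N (D k) k) k = D k from Set.ext fun x => (hmem k x).symm]
  exact hD k

lemma iInter_closure_image_boundedPrefix_subset {X : Type*} [TopologicalSpace X]
    [TopologicalSpace.MetrizableSpace X] {f : (ℕ → ℕ) → X} (hf : Continuous f) (s : ℕ → ℕ) :
    ⋂ k, closure (f '' boundedPrefix s k) ⊆ range f := by
  let := TopologicalSpace.metrizableSpaceMetric X
  intro y hy
  have h1 : ∀ k : ℕ, ∃ x ∈ boundedPrefix s k, dist y (f x) < 1 / ((k : ℝ) + 1) := by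
    intro k
    obtain ⟨b, ⟨x, hx, rfl⟩, hb⟩ :=
      Metric.mem_closure_iff.1 (mem_iInter.1 hy k) (1 / ((k : ℝ) + 1)) (by positivity)
    exact ⟨x, hx, hb⟩
  choose x hx hxy using h1
  let z : ℕ → ℕ → ℕ := fun k i => if i < k then x k i else 0
  have hz : ∀ k, z k ∈ Set.pi univ fun i => Set.Iic (s i) := by
    intro k i _
    simp only [z, Set.mem_Iic]
    split_ifs with h
    · exact hx k i h
    · exact Nat.zero_le _
  have hcomp : IsCompact (Set.pi univ fun i => Set.Iic (s i)) :=
    isCompact_univ_pi fun i => (Set.finite_Iic _).isCompact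
  obtain ⟨a, -, φ, hφ, ha⟩ := hcomp.tendsto_subseq hz
  have hxa : Tendsto (x ∘ φ) atTop (𝓝 a) := by
    rw [tendsto_pi_nhds] at ha ⊢
    intro i
    refine (ha i).congr' ?_
    filter_upwards [eventually_gt_atTop i] with k hk
    simp only [Function.comp, z]
    rw [if_pos (hk.trans_le (hφ.id_le k))]
  have h2 : Tendsto (fun k => f (x (φ k))) atTop (𝓝 (f a)) := (hf.tendsto a).comp hxa
  have h3 : Tendsto (fun k => f (x k)) atTop (𝓝 y) := by
    rw [tendsto_iff_dist_tendsto_zero]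
    refine squeeze_zero (fun _ => dist_nonneg) (fun k => ?_) tendsto_one_div_add_atTop_nhds_zero_nat
    rw [dist_comm]; exact (hxy k).le
  exact ⟨a, tendsto_nhds_unique h2 (h3.comp hφ.tendsto_atTop)⟩

lemma antitone_boundedPrefix (s : ℕ → ℕ) : Antitone (boundedPrefix s) :=
  fun _ _ hab _ hx i hi => hx i (hi.trans_le hab)

lemma le_measure_iInter_closure_image_boundedPrefix {X : Type*} [TopologicalSpace X]
    [MeasurableSpace X] [OpensMeasurableSpace X] (ν : Measure X) [IsFiniteMeasure ν]
    (f : (ℕ → ℕ) → X) (s : ℕ → ℕ) {r : ℝ≥0∞}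
    (h : ∀ k, r ≤ ν (closure (f '' boundedPrefix s k))) :
    r ≤ ν (⋂ k, closure (f '' boundedPrefix s k)) := by
  rw [Antitone.measure_iInter]
  · exact le_iInf h
  · exact fun a b hab => closure_mono (image_mono (antitone_boundedPrefix s hab))
  · exact fun k => isClosed_closure.measurableSet.nullMeasurableSet
  · exact ⟨0, measure_ne_top _ _⟩

lemma MeasureTheory.AnalyticSet.nullMeasurableSet {X : Type*} [TopologicalSpace X]
    [TopologicalSpace.MetrizableSpace X] [MeasurableSpace X] [OpensMeasurableSpace X]
    {A : Set X} (hA : AnalyticSet A) (ν : Measure X) [IsFiniteMeasure ν] :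
    NullMeasurableSet A ν := by
  rw [AnalyticSet] at hA
  rcases hA with rfl | ⟨f, hf, rfl⟩
  · exact nullMeasurableSet_empty
  by_cases h0 : ν (range f) = 0
  · exact NullMeasurableSet.of_null h0
  have key : ∀ r < ν (range f), ∃ C ⊆ range f, MeasurableSet C ∧ r ≤ ν C := by
    intro r hr
    obtain ⟨s, hs⟩ := exists_boundedPrefix_measure_gt ν f hr
    exact ⟨_, iInter_closure_image_boundedPrefix_subset hf s,
      MeasurableSet.iInter fun k => isClosed_closure.measurableSet,
      le_measure_iInter_closure_image_boundedPrefix ν f s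
        fun k => (hs k).le.trans (measure_mono subset_closure)⟩
  obtain ⟨u, -, hu1, hu2⟩ := exists_seq_strictMono_tendsto' (pos_iff_ne_zero.2 h0)
  choose C hCs hCm hCr using fun n => key (u n) (hu1 n).2
  set S := ⋃ n, C n
  have hSs : S ⊆ range f := iUnion_subset hCs
  have hSm : MeasurableSet S := MeasurableSet.iUnion hCm
  have hle : ν (range f) ≤ ν S :=
    le_of_tendsto' hu2 fun n => (hCr n).trans (measure_mono (subset_iUnion C n))
  have hae : S =ᵐ[ν] range f := ae_eq_of_subset_of_measure_ge hSs hle hSm.nullMeasurableSet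
    (measure_ne_top _ _)
  exact hSm.nullMeasurableSet.congr hae

lemma MeasureTheory.AnalyticSet.univMeasurableSet {X : Type*} [TopologicalSpace X]
    [TopologicalSpace.MetrizableSpace X] [MeasurableSpace X] [OpensMeasurableSpace X]
    {A : Set X} (hA : AnalyticSet A) : UnivMeasurableSet A :=
  fun μ _ => hA.nullMeasurableSet μ

lemma MeasureTheory.AnalyticSet.setOf_measure_pos {Z X : Type*} [TopologicalSpace Z] [PolishSpace Z]
    [MeasurableSpace Z] [BorelSpace Z] [TopologicalSpace X]
    [TopologicalSpace.MetrizableSpace X] [MeasurableSpace X] [OpensMeasurableSpace X]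
    {A : Set X} (hA : AnalyticSet A) {κ : Z → Measure X} (hκ : Measurable κ)
    [∀ z, IsFiniteMeasure (κ z)] : AnalyticSet {z | 0 < κ z A} := by
  rw [AnalyticSet] at hA
  rcases hA with rfl | ⟨f, hf, rfl⟩
  · simpa using analyticSet_empty
  set W : Set (Z × (ℕ → ℕ) × ℕ) :=
    {p | ∀ k, ((p.2.2 : ℝ≥0∞) + 1)⁻¹ ≤ κ p.1 (closure (f '' boundedPrefix p.2.1 k))}
  have hW : MeasurableSet W := by
    have : W = ⋂ k, {p : Z × (ℕ → ℕ) × ℕ |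
        ((p.2.2 : ℝ≥0∞) + 1)⁻¹ ≤ κ p.1 (closure (f '' boundedPrefix p.2.1 k))} := by
      ext p; simp [W]
    rw [this]
    refine MeasurableSet.iInter fun k => measurableSet_le ?_ ?_
    · exact (measurable_from_nat (f := fun n : ℕ => ((n : ℝ≥0∞) + 1)⁻¹)).comp
        (measurable_snd.comp measurable_snd)
    · let G : Z × (Fin k → ℕ) → ℝ≥0∞ := fun q =>
        κ q.1 (closure (f '' {x | ∀ i : Fin k, x i ≤ q.2 i}))
      have hG : Measurable G := measurable_from_prod_countable_left fun u =>
        (Measure.measurable_coe (s := closure (f '' {x | ∀ i : Fin k, x i ≤ u i}))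
          isClosed_closure.measurableSet).comp hκ
      have hr : Measurable fun p : Z × (ℕ → ℕ) × ℕ => (p.1, fun i : Fin k => p.2.1 i) := by
        fun_prop
      convert hG.comp hr using 1
      ext p
      simp only [G, Function.comp]
      congr 3
      ext x
      simp only [boundedPrefix, mem_ofPred_eq]
      exact ⟨fun h i => h i i.2, fun h i hi => h ⟨i, hi⟩⟩
  have heq : {z | 0 < κ z (range f)} = Prod.fst '' W := by
    ext z
    simp only [mem_ofPred_eq, mem_image, W, Prod.exists, exists_and_right, exists_eq_right]
    constructor
    · intro h
      obtain ⟨r, hr0, hr⟩ := exists_between h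
      obtain ⟨s, hs⟩ := exists_boundedPrefix_measure_gt (κ z) f hr
      obtain ⟨m, hm⟩ := ENNReal.exists_inv_nat_lt hr0.ne'
      refine ⟨s, m, fun k => ?_⟩
      refine le_trans ?_ ((hm.trans (hs k)).le.trans (measure_mono subset_closure))
      exact ENNReal.inv_le_inv.2 le_self_add
    · rintro ⟨s, m, h⟩
      have h1 := le_measure_iInter_closure_image_boundedPrefix (κ z) f s h
      refine lt_of_lt_of_le ?_ (h1.trans
        (measure_mono (iInter_closure_image_boundedPrefix_subset hf s)))
      exact ENNReal.inv_pos.2 (by simp)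
  rw [heq]
  exact hW.analyticSet.image_of_continuous continuous_fst

lemma MeasureTheory.AnalyticSet.inter {X : Type*} [TopologicalSpace X] [T2Space X] {s t : Set X}
    (hs : AnalyticSet s) (ht : AnalyticSet t) : AnalyticSet (s ∩ t) := by
  rw [inter_eq_iInter]
  exact AnalyticSet.iInter (by rintro (_ | _) <;> assumption)

lemma MeasureTheory.AnalyticSet.union {X : Type*} [TopologicalSpace X] {s t : Set X}
    (hs : AnalyticSet s) (ht : AnalyticSet t) : AnalyticSet (s ∪ t) := by
  rw [union_eq_iUnion]
  exact AnalyticSet.iUnion (by rintro (_ | _) <;> assumption)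

lemma IsOpen.analyticSet_of_polishSpace {X : Type*} [TopologicalSpace X] [PolishSpace X]
    {s : Set X} (hs : IsOpen s) : AnalyticSet s := by
  simpa using hs.analyticSet_image continuous_id

/-- The points where a set-valued map with analytic graph meets an open set form an analytic
set. -/
lemma analyticSet_setOf_inter_nonempty {X E : Type*} [TopologicalSpace X] [PolishSpace X]
    [TopologicalSpace E] [PolishSpace E] {C : X → Set E}
    (hC : AnalyticSet {p : X × E | p.2 ∈ C p.1}) {U : Set E} (hU : IsOpen U) :
    AnalyticSet {x | (C x ∩ U).Nonempty} := by
  have h := (hC.inter (hU.preimage continuous_snd).analyticSet_of_polishSpace).image_of_continuous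
    continuous_fst
  convert! h
  ext x
  simp [Set.Nonempty]

lemma analyticSet_setOf_mem_convexHull {X : Type*} [TopologicalSpace X] [PolishSpace X] {d : ℕ}
    {S : X → Set (Fin d → ℝ)} (hS : AnalyticSet {p : X × (Fin d → ℝ) | p.2 ∈ S p.1}) :
    AnalyticSet {p : X × (Fin d → ℝ) | p.2 ∈ convexHull ℝ (S p.1)} := by
  let W : ∀ n : ℕ, Set (X × (Fin n → (Fin d → ℝ)) × (Fin n → ℝ)) := fun n =>
    ⋂ o : Option (Fin n), o.elim {q | (∀ i, 0 ≤ q.2.2 i) ∧ ∑ i, q.2.2 i = 1}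
      fun i => (fun q => (q.1, q.2.1 i)) ⁻¹' {p : X × (Fin d → ℝ) | p.2 ∈ S p.1}
  have hW : ∀ n, AnalyticSet (W n) := by
    intro n
    refine AnalyticSet.iInter fun o => ?_
    cases o with
    | none =>
      apply IsClosed.analyticSet
      have h1 : IsClosed {q : X × (Fin n → (Fin d → ℝ)) × (Fin n → ℝ) | ∀ i, 0 ≤ q.2.2 i} := by
        simp only [ofPred_forall]
        exact isClosed_iInter fun i => isClosed_le continuous_const (by fun_prop)
      have h2 : IsClosed {q : X × (Fin n → (Fin d → ℝ)) × (Fin n → ℝ) | ∑ i, q.2.2 i = 1} :=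
        isClosed_eq (by fun_prop) continuous_const
      exact h1.inter h2
    | some i => exact hS.preimage (by fun_prop)
  have h := AnalyticSet.iUnion fun n => (hW n).image_of_continuous
    (f := fun q : X × (Fin n → (Fin d → ℝ)) × (Fin n → ℝ) => (q.1, ∑ i, q.2.2 i • q.2.1 i))
    (by fun_prop)
  convert! h
  ext ⟨x, y⟩
  simp only [mem_ofPred_eq, mem_iUnion, mem_image, Prod.mk.injEq, Prod.exists]
  constructor
  · intro hy
    obtain ⟨ι, _, w, z, hw0, hw1, hz, hs⟩ := mem_convexHull_iff_exists_fintype.1 hy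
    let e := Fintype.equivFin ι
    refine ⟨Fintype.card ι, x, z ∘ e.symm, w ∘ e.symm, ?_, rfl, ?_⟩
    · simp only [W, mem_iInter]
      rintro (_ | i)
      · refine ⟨fun i => hw0 _, ?_⟩
        rw [← hw1]
        exact e.symm.sum_comp w
      · exact hz _
    · rw [← hs]
      exact e.symm.sum_comp fun i => w i • z i
  · rintro ⟨n, x', z, w, hq, rfl, rfl⟩
    simp only [W, mem_iInter] at hq
    exact mem_convexHull_of_exists_fintype w z (hq none).1 (hq none).2 (fun i => hq (some i)) rfl

lemma analyticSet_setOf_mem_closure {X : Type*} [TopologicalSpace X] [PolishSpace X] {d : ℕ}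
    {S : X → Set (Fin d → ℝ)} (hS : AnalyticSet {p : X × (Fin d → ℝ) | p.2 ∈ S p.1}) :
    AnalyticSet {p : X × (Fin d → ℝ) | p.2 ∈ closure (S p.1)} := by
  let W : ∀ n : ℕ, Set (X × (Fin d → ℝ) × (Fin d → ℝ)) := fun n =>
    ((fun q => (q.1, q.2.2)) ⁻¹' {p : X × (Fin d → ℝ) | p.2 ∈ S p.1}) ∩
      {q | dist q.2.1 q.2.2 < 1 / ((n : ℝ) + 1)}
  have hW : ∀ n, AnalyticSet (W n) := fun n =>
    (hS.preimage (by fun_prop)).inter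
      (isOpen_lt (by fun_prop) continuous_const).analyticSet_of_polishSpace
  have h := AnalyticSet.iInter fun n => (hW n).image_of_continuous
    (f := fun q : X × (Fin d → ℝ) × (Fin d → ℝ) => (q.1, q.2.1)) (by fun_prop)
  convert! h
  ext ⟨x, y⟩
  simp only [mem_ofPred_eq, mem_iInter, mem_image, W, mem_inter_iff, mem_preimage, Prod.exists,
    Prod.mk.injEq]
  rw [Metric.mem_closure_iff]
  constructor
  · intro h n
    obtain ⟨b, hb, hd⟩ := h (1 / ((n : ℝ) + 1)) (by positivity)
    exact ⟨x, y, b, ⟨hb, hd⟩, rfl, rfl⟩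
  · intro h ε hε
    obtain ⟨n, hn⟩ := exists_nat_one_div_lt hε
    obtain ⟨_, _, b, ⟨hb, hd⟩, rfl, rfl⟩ := h n
    exact ⟨b, hb, hd.trans hn⟩

lemma Continuous.measurable_toMeasure {Z X : Type*} [TopologicalSpace Z] [MeasurableSpace Z]
    [OpensMeasurableSpace Z] [TopologicalSpace X] [TopologicalSpace.MetrizableSpace X]
    [MeasurableSpace X] [BorelSpace X] {g : Z → ProbabilityMeasure X} (hg : Continuous g) :
    Measurable fun z => (g z : Measure X) := by
  let := TopologicalSpace.metrizableSpaceMetric X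
  refine Measurable.measure_of_isPiSystem_of_isProbabilityMeasure (S := {F | IsClosed F})
    (by rw [BorelSpace.measurable_eq (α := X), borel_eq_generateFrom_isClosed])
    isPiSystem_isClosed fun F hF => UpperSemicontinuous.measurable ?_
  rw [upperSemicontinuous_iff_limsup_le]
  exact fun z => ProbabilityMeasure.limsup_measure_closed_le_of_tendsto (hg.tendsto z) hF

section Support

variable {α : Type*} [MeasurableSpace α] {d : ℕ} {𝒬 : Set (ProbabilityMeasure α)}
  {C : α → Set (Fin d → ℝ)}

lemma measure_inter_compl_nonempty_eq_zero_iff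
    (hC : ∀ U : Set (Fin d → ℝ), IsOpen U → ∀ P ∈ 𝒬,
      NullMeasurableSet {x | (C x ∩ U).Nonempty} (P : Measure α))
    {F : Set (Fin d → ℝ)} (hF : IsClosed F) {P : ProbabilityMeasure α} (hP : P ∈ 𝒬) :
    (P : Measure α) {x | C x ⊆ F} = 1 ↔ (P : Measure α) {x | (C x ∩ Fᶜ).Nonempty} = 0 := by
  have hcompl : {x | C x ⊆ F} = {x | (C x ∩ Fᶜ).Nonempty}ᶜ := by
    ext x
    simp only [mem_ofPred_eq, mem_compl_iff, not_nonempty_iff_eq_empty, ← sdiff_eq,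
      sdiff_eq_empty]
  rw [hcompl, prob_compl_eq_one_iff₀ (hC _ hF.isOpen_compl P hP)]

lemma mem_svSupport_iff
    (hC : ∀ U : Set (Fin d → ℝ), IsOpen U → ∀ P ∈ 𝒬,
      NullMeasurableSet {x | (C x ∩ U).Nonempty} (P : Measure α)) {y : Fin d → ℝ} :
    y ∈ svSupport 𝒬 C ↔ ∀ U ∈ TopologicalSpace.countableBasis (Fin d → ℝ), y ∈ U →
      ∃ P ∈ 𝒬, 0 < (P : Measure α) {x | (C x ∩ U).Nonempty} := by
  constructor
  · intro hy U hU hyU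
    by_contra hcon
    push Not at hcon
    have hUo := (TopologicalSpace.isBasis_countableBasis (Fin d → ℝ)).isOpen hU
    refine (hy Uᶜ ⟨hUo.isClosed_compl, fun P hP => ?_⟩) hyU
    rw [measure_inter_compl_nonempty_eq_zero_iff hC hUo.isClosed_compl hP, compl_compl]
    exact le_zero_iff.1 (hcon P hP)
  · rintro hy F ⟨hF, hF1⟩
    by_contra hyF
    obtain ⟨U, hU, hyU, hUF⟩ := (TopologicalSpace.isBasis_countableBasis
      (Fin d → ℝ)).exists_subset_of_mem_open (show y ∈ Fᶜ from hyF) hF.isOpen_compl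
    obtain ⟨P, hP, hpos⟩ := hy U hU hyU
    have h0 := (measure_inter_compl_nonempty_eq_zero_iff hC hF hP).1 (hF1 P hP)
    exact hpos.ne' (measure_mono_null (fun x hx => hx.mono (inter_subset_inter_right _ hUF)) h0)

lemma ae_subset_svSupport
    (hC : ∀ U : Set (Fin d → ℝ), IsOpen U → ∀ P ∈ 𝒬,
      NullMeasurableSet {x | (C x ∩ U).Nonempty} (P : Measure α))
    {P : ProbabilityMeasure α} (hP : P ∈ 𝒬) : ∀ᵐ x ∂(P : Measure α), C x ⊆ svSupport 𝒬 C := by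
  have h : ∀ U ∈ TopologicalSpace.countableBasis (Fin d → ℝ), ∀ᵐ x ∂(P : Measure α),
      (P : Measure α) {x | (C x ∩ U).Nonempty} = 0 → ¬ (C x ∩ U).Nonempty := by
    intro U _
    by_cases h0 : (P : Measure α) {x | (C x ∩ U).Nonempty} = 0
    · have : ∀ᵐ x ∂(P : Measure α), ¬ (C x ∩ U).Nonempty := by
        rw [ae_iff]; simpa using h0
      filter_upwards [this] with x hx _ using hx
    · exact Eventually.of_forall fun x hx => absurd hx h0
  rw [← ae_ball_iff (TopologicalSpace.countable_countableBasis _)] at h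
  filter_upwards [h] with x hx y hy F hF
  by_contra hyF
  obtain ⟨U, hU, hyU, hUF⟩ := (TopologicalSpace.isBasis_countableBasis
    (Fin d → ℝ)).exists_subset_of_mem_open (show y ∈ Fᶜ from hyF) hF.1.isOpen_compl
  refine hx U hU ?_ ⟨y, hy, hyU⟩
  exact measure_mono_null (fun x hx => hx.mono (inter_subset_inter_right _ hUF))
    ((measure_inter_compl_nonempty_eq_zero_iff hC hF.1 hP).1 (hF.2 P hP))

end Support

lemma nullMeasurableSet_section_inter_nonempty {X Y : Type*} [TopologicalSpace X]
    [PolishSpace X] [TopologicalSpace Y] [PolishSpace Y] [MeasurableSpace Y] [BorelSpace Y] {d : ℕ}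
    {C : X → Y → Set (Fin d → ℝ)}
    (hC : AnalyticSet {p : (X × Y) × (Fin d → ℝ) | p.2 ∈ C p.1.1 p.1.2})
    {U : Set (Fin d → ℝ)} (hU : IsOpen U) (x : X) (P : ProbabilityMeasure Y) :
    NullMeasurableSet {y | (C x y ∩ U).Nonempty} (P : Measure Y) := by
  have h := analyticSet_setOf_inter_nonempty (C := fun p : X × Y => C p.1 p.2) hC hU
  exact (h.preimage (f := fun y : Y => (x, y)) (by fun_prop)).nullMeasurableSet _

section SupportGraph

variable {X Y : Type*} [TopologicalSpace X] [PolishSpace X] [MeasurableSpace X] [BorelSpace X]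
  [TopologicalSpace Y] [PolishSpace Y] [MeasurableSpace Y] [BorelSpace Y] {d : ℕ}

lemma analyticSet_setOf_exists_measure_pos {𝒬 : X → Set (ProbabilityMeasure Y)}
    (h𝒬 : AnalyticSet {p : X × ProbabilityMeasure Y | p.2 ∈ 𝒬 p.1}) {A : Set (X × Y)}
    (hA : AnalyticSet A) :
    AnalyticSet {x | ∃ P ∈ 𝒬 x, 0 < (P : Measure Y) {y | (x, y) ∈ A}} := by
  rw [AnalyticSet] at h𝒬
  rcases h𝒬 with h | ⟨g, hg, hrange⟩
  · convert! analyticSet_empty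
    rw [eq_empty_iff_forall_notMem] at h ⊢
    rintro x ⟨P, hP, -⟩
    exact h (x, P) hP
  · let κ : (ℕ → ℕ) → Measure (X × Y) := fun z =>
      (Measure.dirac (g z).1).prod ((g z).2 : Measure Y)
    have hg1 : Continuous fun z => (g z).1 := continuous_fst.comp hg
    have hg2 : Measurable fun z => ((g z).2 : Measure Y) :=
      (continuous_snd.comp hg).measurable_toMeasure
    have hκ : Measurable κ := by
      refine Measurable.measure_of_isPiSystem_of_isProbabilityMeasure generateFrom_prod.symm
        isPiSystem_prod ?_
      rintro _ ⟨u, hu, v, hv, rfl⟩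
      simp only [κ, Measure.prod_prod]
      exact ((Measure.measurable_coe hu).comp
        (Measure.measurable_dirac.comp hg1.measurable)).mul ((Measure.measurable_coe hv).comp hg2)
    have h := (hA.setOf_measure_pos hκ).image_of_continuous hg1
    convert! h
    have hval : ∀ z, κ z A = ((g z).2 : Measure Y) {y | ((g z).1, y) ∈ A} := by
      intro z
      have : κ z = ((g z).2 : Measure Y).map (Prod.mk (g z).1) := Measure.dirac_prod _
      rw [this, Measure.map_apply₀ (by fun_prop) (hA.nullMeasurableSet _)]
      rfl
    ext x
    simp only [mem_ofPred_eq, mem_image, hval]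
    constructor
    · rintro ⟨P, hP, hpos⟩
      obtain ⟨z, hz⟩ : (x, P) ∈ range g := by rw [hrange]; exact hP
      exact ⟨z, by rw [hz]; exact hpos, by rw [hz]⟩
    · rintro ⟨z, hz, rfl⟩
      refine ⟨(g z).2, ?_, hz⟩
      have : g z ∈ range g := mem_range_self z
      rw [hrange] at this
      exact this

lemma analyticSet_setOf_mem_svSupport {𝒬 : X → Set (ProbabilityMeasure Y)}
    (h𝒬 : AnalyticSet {p : X × ProbabilityMeasure Y | p.2 ∈ 𝒬 p.1})
    {C : X → Y → Set (Fin d → ℝ)}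
    (hC : AnalyticSet {p : (X × Y) × (Fin d → ℝ) | p.2 ∈ C p.1.1 p.1.2}) :
    AnalyticSet {p : X × (Fin d → ℝ) | p.2 ∈ svSupport (𝒬 p.1) (C p.1)} := by
  have hcount := (TopologicalSpace.countable_countableBasis (Fin d → ℝ)).to_subtype
  have hne : Nonempty (TopologicalSpace.countableBasis (Fin d → ℝ)) := by
    obtain ⟨U, hU, -⟩ := (TopologicalSpace.isBasis_countableBasis
      (Fin d → ℝ)).exists_subset_of_mem_open (mem_univ 0) isOpen_univ
    exact ⟨U, hU⟩
  have hb := TopologicalSpace.isBasis_countableBasis (Fin d → ℝ)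
  have h := AnalyticSet.iInter
    (s := fun U : TopologicalSpace.countableBasis (Fin d → ℝ) =>
      (Prod.snd ⁻¹' (U : Set (Fin d → ℝ))ᶜ) ∪ (Prod.fst ⁻¹'
        {x : X | ∃ P ∈ 𝒬 x, 0 < (P : Measure Y) {y | (C x y ∩ U).Nonempty}}))
    fun U => ((hb.isOpen U.2).isClosed_compl.preimage continuous_snd).analyticSet.union
      ((analyticSet_setOf_exists_measure_pos h𝒬 (analyticSet_setOf_inter_nonempty
        (C := fun p : X × Y => C p.1 p.2) hC (hb.isOpen U.2))).preimage continuous_fst)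
  convert! h
  ext ⟨x, y⟩
  rw [mem_ofPred_eq, mem_svSupport_iff
    fun U hU P _ => nullMeasurableSet_section_inter_nonempty hC hU x P]
  simp only [mem_iInter, mem_union, mem_preimage, mem_compl_iff, Subtype.forall, mem_ofPred_eq,
    ← imp_iff_not_or]

end SupportGraph

/-- The Kuratowski–Ryll-Nardzewski measurable selection theorem. -/
lemma exists_measurable_selection {α X : Type*} [MeasurableSpace α] [TopologicalSpace X]
    [PolishSpace X] [MeasurableSpace X] [BorelSpace X] {F : α → Set X}
    (hcl : ∀ ω, IsClosed (F ω)) (hne : ∀ ω, (F ω).Nonempty)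
    (hm : ∀ U, IsOpen U → MeasurableSet {ω | (F ω ∩ U).Nonempty}) :
    ∃ g : α → X, Measurable g ∧ ∀ ω, g ω ∈ F ω := by
  classical
  let := TopologicalSpace.upgradeIsCompletelyMetrizable X
  rcases isEmpty_or_nonempty α with hα | ⟨⟨ω₀⟩⟩
  · exact ⟨fun ω => (hα.false ω).elim, measurable_of_empty _, fun ω => (hα.false ω).elim⟩
  have : Nonempty X := ⟨(hne ω₀).some⟩
  let D := TopologicalSpace.denseSeq X
  have hD : DenseRange D := TopologicalSpace.denseRange_denseSeq X
  let good : ℕ → (α → ℕ) → Prop := fun n I =>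
    Measurable I ∧ ∀ ω, (F ω ∩ Metric.ball (D (I ω)) ((1 / 2 : ℝ) ^ n)).Nonempty
  have h0 : ∃ I, good 0 I := by
    have hex : ∀ ω, ∃ i, (F ω ∩ Metric.ball (D i) ((1 / 2 : ℝ) ^ 0)).Nonempty := by
      intro ω
      obtain ⟨y, hy⟩ := hne ω
      obtain ⟨i, hi⟩ := hD.exists_dist_lt y (show (0 : ℝ) < (1 / 2) ^ 0 by positivity)
      exact ⟨i, y, hy, hi⟩
    exact ⟨fun ω => Nat.find (hex ω), measurable_find hex fun i => hm _ Metric.isOpen_ball,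
      fun ω => Nat.find_spec (hex ω)⟩
  have hstep : ∀ n I, good n I → ∃ J, good (n + 1) J ∧
      ∀ ω, dist (D (I ω)) (D (J ω)) ≤ 2 * (1 / 2 : ℝ) ^ n := by
    rintro n I ⟨hI, hIF⟩
    have hex : ∀ ω, ∃ i, (F ω ∩ (Metric.ball (D (I ω)) ((1 / 2 : ℝ) ^ n) ∩
        Metric.ball (D i) ((1 / 2 : ℝ) ^ (n + 1)))).Nonempty := by
      intro ω
      obtain ⟨y, hy, hyI⟩ := hIF ω
      obtain ⟨i, hi⟩ := hD.exists_dist_lt y (show (0 : ℝ) < (1 / 2) ^ (n + 1) by positivity)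
      exact ⟨i, y, hy, hyI, hi⟩
    have hspec := fun ω => Nat.find_spec (hex ω)
    refine ⟨fun ω => Nat.find (hex ω), ⟨measurable_find hex fun i => ?_, fun ω => ?_⟩, fun ω => ?_⟩
    · have : {ω | (F ω ∩ (Metric.ball (D (I ω)) ((1 / 2 : ℝ) ^ n) ∩
          Metric.ball (D i) ((1 / 2 : ℝ) ^ (n + 1)))).Nonempty} =
          ⋃ j, I ⁻¹' {j} ∩ {ω | (F ω ∩ (Metric.ball (D j) ((1 / 2 : ℝ) ^ n) ∩
            Metric.ball (D i) ((1 / 2 : ℝ) ^ (n + 1)))).Nonempty} := by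
        ext ω; simp
      rw [this]
      exact MeasurableSet.iUnion fun j => (hI (measurableSet_singleton j)).inter
        (hm _ (Metric.isOpen_ball.inter Metric.isOpen_ball))
    · exact (hspec ω).mono fun y hy => ⟨hy.1, hy.2.2⟩
    · obtain ⟨y, -, hy1, hy2⟩ := hspec ω
      rw [Metric.mem_ball] at hy1 hy2
      have hle : (1 / 2 : ℝ) ^ (n + 1) ≤ (1 / 2) ^ n :=
        pow_le_pow_of_le_one (by norm_num) (by norm_num) (Nat.le_succ n)
      have := dist_triangle_left (D (I ω)) (D (Nat.find (hex ω))) y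
      linarith
  obtain ⟨I0, hI0⟩ := h0
  choose! J hJ using hstep
  let I : ℕ → α → ℕ := fun n => Nat.rec I0 J n
  have hI : ∀ n, good n (I n) := fun n => by
    induction n with
    | zero => exact hI0
    | succ n ih => exact (hJ n _ ih).1
  have hlim : ∀ ω, ∃ y, Tendsto (fun n => D (I n ω)) atTop (𝓝 y) := fun ω =>
    cauchySeq_tendsto_of_complete
      (cauchySeq_of_le_geometric (1 / 2) 2 (by norm_num) fun n => (hJ n _ (hI n)).2 ω)
  choose g hg using hlim
  refine ⟨g, measurable_of_tendsto_metrizable (fun n => measurable_from_nat.comp (hI n).1)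
    (tendsto_pi_nhds.2 hg), fun ω => ?_⟩
  choose y hyF hyI using fun n => (hI n).2 ω
  refine (hcl ω).mem_of_tendsto (b := atTop) (f := y) ?_ (Eventually.of_forall hyF)
  have hd : Tendsto (fun n => dist (D (I n ω)) (y n)) atTop (𝓝 0) :=
    squeeze_zero (fun _ => dist_nonneg) (fun n => by rw [dist_comm]; exact (hyI n).le)
      (tendsto_pow_atTop_nhds_zero_of_lt_one (by norm_num) (by norm_num))
  exact (hg ω).congr_dist hd

/-- A set-valued map that is the superlevel set of a Carathéodory function. -/
def IsCaratheodorySet {α : Type*} [MeasurableSpace α] {d : ℕ} (G : α → Set (Fin d → ℝ)) : Prop :=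
  ∃ φ : α → (Fin d → ℝ) → ℝ, (∀ x, Measurable fun ω => φ ω x) ∧ (∀ ω, Continuous (φ ω)) ∧
    ∀ ω x, x ∈ G ω ↔ 0 ≤ φ ω x

namespace IsCaratheodorySet

variable {α : Type*} [MeasurableSpace α] {d : ℕ} {G H : α → Set (Fin d → ℝ)}

lemma isClosed (hG : IsCaratheodorySet G) (ω : α) : IsClosed (G ω) := by
  obtain ⟨φ, -, hc, h⟩ := hG
  have : G ω = {x | 0 ≤ φ ω x} := Set.ext (h ω)
  rw [this]
  exact isClosed_le continuous_const (hc ω)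

lemma inter (hG : IsCaratheodorySet G) (hH : IsCaratheodorySet H) :
    IsCaratheodorySet fun ω => G ω ∩ H ω := by
  obtain ⟨φ, hm, hc, h⟩ := hG
  obtain ⟨ψ, hm', hc', h'⟩ := hH
  refine ⟨fun ω x => min (φ ω x) (ψ ω x), fun x => (hm x).min (hm' x),
    fun ω => (hc ω).min (hc' ω), fun ω x => ?_⟩
  rw [mem_inter_iff, h, h', le_min_iff]

lemma preimage (hG : IsCaratheodorySet G) {T : α → (Fin d → ℝ) → (Fin d → ℝ)}
    (hT : ∀ x, Measurable fun ω => T ω x) (hTc : ∀ ω, Continuous (T ω)) :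
    IsCaratheodorySet fun ω => T ω ⁻¹' G ω := by
  obtain ⟨φ, hm, hc, h⟩ := hG
  refine ⟨fun ω x => φ ω (T ω x), fun x => ?_, fun ω => (hc ω).comp (hTc ω), fun ω x => h ω _⟩
  have hu : Measurable (Function.uncurry fun x ω => φ ω x) :=
    measurable_uncurry_of_continuous_of_measurable (u := fun x ω => φ ω x) hc hm
  exact hu.comp ((hT x).prodMk measurable_id)

lemma neg (hG : IsCaratheodorySet G) : IsCaratheodorySet fun ω => {x | -x ∈ G ω} :=
  hG.preimage (T := fun _ x => -x) (fun _ => measurable_const) fun _ => continuous_neg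

lemma sub (hG : IsCaratheodorySet G) {f : α → Fin d → ℝ} (hf : Measurable f) :
    IsCaratheodorySet fun ω => {x | f ω - x ∈ G ω} :=
  hG.preimage (T := fun ω x => f ω - x) (fun x => hf.sub_const x)
    fun _ => continuous_const.sub continuous_id

lemma sphere : IsCaratheodorySet fun _ : α => Metric.sphere (0 : Fin d → ℝ) 1 :=
  ⟨fun _ x => -|‖x‖ - 1|, fun _ => measurable_const, fun _ => by fun_prop, fun _ x => by
    rw [mem_sphere_zero_iff_norm, neg_nonneg, abs_nonpos_iff, sub_eq_zero]⟩

lemma measurableSet_mem (hG : IsCaratheodorySet G) {f : α → Fin d → ℝ} (hf : Measurable f) :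
    MeasurableSet {ω | f ω ∈ G ω} := by
  obtain ⟨φ, hm, hc, h⟩ := hG
  have hu : Measurable (Function.uncurry fun x ω => φ ω x) :=
    measurable_uncurry_of_continuous_of_measurable (u := fun x ω => φ ω x) hc hm
  have : {ω | f ω ∈ G ω} = {ω | 0 ≤ Function.uncurry (fun x ω => φ ω x) (f ω, ω)} :=
    Set.ext fun ω => h ω _
  rw [this]
  exact measurableSet_le measurable_const (hu.comp (hf.prodMk measurable_id))

lemma measurableSet_inter_closedBall (hG : IsCaratheodorySet G) (x : Fin d → ℝ) (r : ℝ) :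
    MeasurableSet {ω | (G ω ∩ Metric.closedBall x r).Nonempty} := by
  obtain ⟨φ, hm, hc, h⟩ := hG
  let D := TopologicalSpace.denseSeq (Fin d → ℝ)
  have hD : DenseRange D := TopologicalSpace.denseRange_denseSeq _
  have heq : {ω | (G ω ∩ Metric.closedBall x r).Nonempty} = ⋂ n : ℕ, ⋃ i : ℕ,
      {ω | dist (D i) x < r + 1 / ((n : ℝ) + 1)} ∩ {ω | -(1 / ((n : ℝ) + 1)) < φ ω (D i)} := by
    ext ω
    simp only [mem_iInter, mem_iUnion, mem_inter_iff, mem_ofPred_eq]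
    constructor
    · rintro ⟨y, hy, hyr⟩ n
      rw [Metric.mem_closedBall] at hyr
      rw [h] at hy
      have hpos : 0 < 1 / ((n : ℝ) + 1) := by positivity
      have ho : IsOpen {z | dist z x < r + 1 / ((n : ℝ) + 1) ∧ -(1 / ((n : ℝ) + 1)) < φ ω z} :=
        (isOpen_lt (continuous_id.dist continuous_const) continuous_const).inter
          (isOpen_lt continuous_const (hc ω))
      exact hD.exists_mem_open ho ⟨y, by linarith, by linarith⟩
    · intro hω
      choose i hi1 hi2 using hω
      have hb : ∀ n, D (i n) ∈ Metric.closedBall x (r + 1) := by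
        intro n
        have : 1 / ((n : ℝ) + 1) ≤ 1 := by
          rw [div_le_one (by positivity)]; linarith [n.cast_nonneg (α := ℝ)]
        rw [Metric.mem_closedBall]
        linarith [hi1 n]
      obtain ⟨y, -, θ, hθ, hy⟩ := (isCompact_closedBall x (r + 1)).tendsto_subseq hb
      have hz : Tendsto (fun n => 1 / ((θ n : ℝ) + 1)) atTop (𝓝 0) :=
        tendsto_one_div_add_atTop_nhds_zero_nat.comp hθ.tendsto_atTop
      refine ⟨y, (h ω y).2 ?_, ?_⟩
      · have h1 : Tendsto (fun n => φ ω (D (i (θ n)))) atTop (𝓝 (φ ω y)) :=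
          ((hc ω).tendsto y).comp hy
        have := le_of_tendsto_of_tendsto' hz.neg h1 fun n => (hi2 (θ n)).le
        simpa using this
      · have h1 : Tendsto (fun n => dist (D (i (θ n))) x) atTop (𝓝 (dist y x)) :=
          hy.dist tendsto_const_nhds
        have := le_of_tendsto_of_tendsto' h1 (tendsto_const_nhds.add hz) fun n => (hi1 (θ n)).le
        simpa using this
  rw [heq]
  exact MeasurableSet.iInter fun n => MeasurableSet.iUnion fun i =>
    (MeasurableSet.const _).inter (measurableSet_lt measurable_const (hm _))

lemma measurableSet_inter_open (hG : IsCaratheodorySet G) {U : Set (Fin d → ℝ)} (hU : IsOpen U) :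
    MeasurableSet {ω | (G ω ∩ U).Nonempty} := by
  let D := TopologicalSpace.denseSeq (Fin d → ℝ)
  have hD : DenseRange D := TopologicalSpace.denseRange_denseSeq _
  have heq : {ω | (G ω ∩ U).Nonempty} = ⋃ i : ℕ, ⋃ n : ℕ,
      {ω | Metric.closedBall (D i) (1 / ((n : ℝ) + 1)) ⊆ U} ∩
        {ω | (G ω ∩ Metric.closedBall (D i) (1 / ((n : ℝ) + 1))).Nonempty} := by
    ext ω
    simp only [mem_iUnion, mem_inter_iff, mem_ofPred_eq]
    constructor
    · rintro ⟨y, hy, hyU⟩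
      obtain ⟨ε, hε, hεU⟩ := Metric.isOpen_iff.1 hU y hyU
      obtain ⟨n, hn⟩ := exists_nat_one_div_lt (half_pos hε)
      obtain ⟨i, hi⟩ := hD.exists_dist_lt y (show (0 : ℝ) < 1 / ((n : ℝ) + 1) by positivity)
      refine ⟨i, n, fun z hz => hεU ?_, y, hy, hi.le⟩
      rw [Metric.mem_closedBall] at hz
      rw [Metric.mem_ball]
      have := dist_triangle z (D i) y
      rw [dist_comm] at hi
      linarith
    · rintro ⟨i, n, hs, h⟩
      exact h.mono (inter_subset_inter_right _ hs)
  rw [heq]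
  exact MeasurableSet.iUnion fun i => MeasurableSet.iUnion fun n =>
    (MeasurableSet.const _).inter (hG.measurableSet_inter_closedBall _ _)

lemma measurableSet_nonempty (hG : IsCaratheodorySet G) : MeasurableSet {ω | (G ω).Nonempty} := by
  simpa using hG.measurableSet_inter_open isOpen_univ

lemma exists_measurable_selection (hG : IsCaratheodorySet G) :
    ∃ g : α → Fin d → ℝ, Measurable g ∧ (∀ ω, (G ω).Nonempty → g ω ∈ G ω) ∧
      ∀ ω, ¬ (G ω).Nonempty → g ω = 0 := by
  classical
  let F : α → Set (Fin d → ℝ) := fun ω => if (G ω).Nonempty then G ω else {0}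
  have hN := hG.measurableSet_nonempty
  have hcl : ∀ ω, IsClosed (F ω) := by
    intro ω
    simp only [F]
    split_ifs
    · exact hG.isClosed ω
    · exact isClosed_singleton
  have hne : ∀ ω, (F ω).Nonempty := by
    intro ω
    simp only [F]
    split_ifs with h
    · exact h
    · exact singleton_nonempty 0
  have hm : ∀ U, IsOpen U → MeasurableSet {ω | (F ω ∩ U).Nonempty} := by
    intro U hU
    have : {ω | (F ω ∩ U).Nonempty} = {ω | (G ω ∩ U).Nonempty} ∪
        ({ω | (G ω).Nonempty}ᶜ ∩ {_ω | (0 : Fin d → ℝ) ∈ U}) := by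
      ext ω
      simp only [F, mem_ofPred_eq, mem_union, mem_inter_iff, mem_compl_iff]
      split_ifs with h
      · simp [h]
      · have : ¬ (G ω ∩ U).Nonempty := fun h' => h h'.left
        simp [h, this]
    rw [this]
    exact (hG.measurableSet_inter_open hU).union (hN.compl.inter (MeasurableSet.const _))
  obtain ⟨g, hgm, hg⟩ := _root_.exists_measurable_selection hcl hne hm
  refine ⟨g, hgm, fun ω hω => ?_, fun ω hω => ?_⟩
  · have := hg ω
    simpa only [F, if_pos hω] using this
  · have := hg ω
    simpa only [F, if_neg hω, mem_singleton_iff] using this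

end IsCaratheodorySet

lemma abs_sum_mul_le {d : ℕ} (y x : Fin d → ℝ) (hy : ‖y‖ ≤ 1) : |∑ i, y i * x i| ≤ d * ‖x‖ := by
  calc |∑ i, y i * x i| ≤ ∑ i, |y i * x i| := Finset.abs_sum_le_sum_abs _ _
    _ ≤ ∑ _i : Fin d, ‖x‖ := by
        refine Finset.sum_le_sum fun i _ => ?_
        rw [abs_mul]
        calc |y i| * |x i| ≤ 1 * ‖x‖ :=
              mul_le_mul ((norm_le_pi_norm y i).trans hy) (norm_le_pi_norm x i) (abs_nonneg _)
                zero_le_one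
          _ = ‖x‖ := one_mul _
    _ = d * ‖x‖ := by simp

/-- The dual cone of a cone-valued map with analytic graph is a superlevel set of a Carathéodory
function for the universal completion. -/
lemma isCaratheodorySet_dualCone {X : Type*} [TopologicalSpace X] [PolishSpace X]
    [MeasurableSpace X] [BorelSpace X] {d : ℕ} {C : X → Set (Fin d → ℝ)}
    (hC : AnalyticSet {p : X × (Fin d → ℝ) | p.2 ∈ C p.1}) (h0 : ∀ ω, 0 ∈ C ω)
    (hcone : ∀ ω, ∀ c : ℝ, 0 ≤ c → ∀ y ∈ C ω, c • y ∈ C ω) :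
    @IsCaratheodorySet X (univComp X) d fun ω => dualCone (C ω) := by
  let V : X → (Fin d → ℝ) → Set ℝ := fun ω x =>
    (fun y : Fin d → ℝ => ∑ i, y i * x i) '' (C ω ∩ Metric.closedBall 0 1)
  have hVne : ∀ ω x, (V ω x).Nonempty := fun ω x =>
    ⟨_, 0, ⟨h0 ω, by simp⟩, rfl⟩
  have hVb : ∀ ω x, BddBelow (V ω x) := by
    refine fun ω x => ⟨-(d * ‖x‖), ?_⟩
    rintro _ ⟨y, ⟨-, hy⟩, rfl⟩
    rw [mem_closedBall_zero_iff] at hy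
    exact (abs_le.1 (abs_sum_mul_le y x hy)).1
  refine ⟨fun ω x => sInf (V ω x), fun x => ?_, fun ω => ?_, fun ω x => ?_⟩
  · refine measurable_of_Iio (δ := X) (mδ := univComp X) fun a => ?_
    have han : AnalyticSet (Prod.fst '' ({p : X × (Fin d → ℝ) | p.2 ∈ C p.1} ∩
        ({p : X × (Fin d → ℝ) | p.2 ∈ Metric.closedBall (0 : Fin d → ℝ) 1} ∩
          {p : X × (Fin d → ℝ) | ∑ i, p.2 i * x i < a}))) := by
      refine (hC.inter (AnalyticSet.inter ?_ ?_)).image_of_continuous continuous_fst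
      · exact (Metric.isClosed_closedBall.preimage continuous_snd).analyticSet
      · exact (isOpen_lt (by fun_prop) continuous_const).analyticSet_of_polishSpace
    have heq : (fun ω => sInf (V ω x)) ⁻¹' Iio a =
        Prod.fst '' ({p : X × (Fin d → ℝ) | p.2 ∈ C p.1} ∩
        ({p : X × (Fin d → ℝ) | p.2 ∈ Metric.closedBall (0 : Fin d → ℝ) 1} ∩
          {p : X × (Fin d → ℝ) | ∑ i, p.2 i * x i < a})) := by
      ext ω
      rw [mem_preimage, mem_Iio, csInf_lt_iff (hVb ω x) (hVne ω x)]
      constructor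
      · rintro ⟨_, ⟨y, ⟨hy, hy1⟩, rfl⟩, hlt⟩
        exact ⟨(ω, y), ⟨hy, hy1, hlt⟩, rfl⟩
      · rintro ⟨⟨_, y⟩, ⟨hy, hy1, hlt⟩, rfl⟩
        exact ⟨_, ⟨y, ⟨hy, hy1⟩, rfl⟩, hlt⟩
    rw [heq]
    exact han.univMeasurableSet
  · refine (LipschitzWith.of_le_add_mul (K := (d : NNReal)) (f := fun x => sInf (V ω x))
      fun x x' => ?_).continuous
    rw [← sub_le_iff_le_add]
    refine le_csInf (hVne ω x') ?_
    rintro _ ⟨y, hy, rfl⟩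
    have h1 : sInf (V ω x) ≤ ∑ i, y i * x i := csInf_le (hVb ω x) ⟨y, hy, rfl⟩
    have h2 := (abs_le.1 (abs_sum_mul_le y (x - x') (mem_closedBall_zero_iff.1 hy.2))).2
    have h3 : ∑ i, y i * (x - x') i = ∑ i, y i * x i - ∑ i, y i * x' i := by
      simp [mul_sub]
    rw [dist_eq_norm]
    simp only [NNReal.coe_natCast]
    linarith
  · constructor
    · intro hx
      refine le_csInf (hVne ω x) ?_
      rintro _ ⟨y, hy, rfl⟩
      exact hx y hy.1
    · intro hx y hy
      have hp : 0 < 1 + ‖y‖ := by positivity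
      have h1 := hx.trans (csInf_le (hVb ω x) ⟨(1 + ‖y‖)⁻¹ • y,
        ⟨hcone ω _ (by positivity) y hy, ?_⟩, rfl⟩)
      · simp only [Pi.smul_apply, smul_eq_mul, mul_assoc, ← Finset.mul_sum] at h1
        exact nonneg_of_mul_nonneg_right h1 (by positivity)
      · rw [mem_closedBall_zero_iff, norm_smul, norm_inv, Real.norm_of_nonneg hp.le,
          inv_mul_le_one₀ hp]
        linarith

lemma UnivMeasurableSet.nullMeasurableSet {α : Type*} [MeasurableSpace α] {s : Set α}
    (hs : UnivMeasurableSet s) (μ : Measure α) [hμ : IsProbabilityMeasure μ] :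
    NullMeasurableSet s μ :=
  hs μ hμ

lemma Measurable.univMeasurable {α β : Type*} [MeasurableSpace α] [MeasurableSpace β] {f : α → β}
    (hf : Measurable f) : UnivMeasurable f :=
  fun _ hs _ _ => (hf hs).nullMeasurableSet

lemma Measurable.univComp_univComp {α β : Type*} [MeasurableSpace α] [MeasurableSpace β]
    {h : α → β} (hh : Measurable h) : Measurable[univComp α, univComp β] h := by
  intro s hs μ hμ
  have := Measure.isProbabilityMeasure_map (μ := μ) hh.aemeasurable
  exact (hs (μ.map h) this).preimage (hh.measurePreserving μ).quasiMeasurePreserving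

lemma UnivMeasurable.comp_measurable {α β γ : Type*} [MeasurableSpace α] [MeasurableSpace β]
    [MeasurableSpace γ] {f : β → γ} {h : α → β} (hf : UnivMeasurable f) (hh : Measurable h) :
    UnivMeasurable fun x => f (h x) :=
  fun _ hs => hh.univComp_univComp (hf hs)

instance {X : Type*} [MeasurableSpace X] [MeasurableSpace.CountablyGenerated X] :
    MeasurableSpace.CountablyGenerated (ProbabilityMeasure X) := by
  obtain ⟨b, hb, hbX⟩ := MeasurableSpace.CountablyGenerated.isCountablyGenerated (α := X)
  have hc : (generateSetAlgebra b).Countable := countable_generateSetAlgebra hb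
  have := hc.to_subtype
  let e : ProbabilityMeasure X → generateSetAlgebra b → ℝ≥0∞ := fun p A => (p : Measure X) A
  have hgen : ‹MeasurableSpace X› = MeasurableSpace.generateFrom (generateSetAlgebra b) := by
    rw [generateFrom_generateSetAlgebra_eq, hbX]
  have hpi : IsPiSystem (generateSetAlgebra b) := fun s hs t ht _ =>
    isSetAlgebra_generateSetAlgebra.inter_mem hs ht
  have hmeas : ∀ A ∈ generateSetAlgebra b, MeasurableSet A := fun A hA => by
    rw [hgen]; exact MeasurableSpace.measurableSet_generateFrom hA
  have heq : (inferInstance : MeasurableSpace (ProbabilityMeasure X)) =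
      MeasurableSpace.comap e MeasurableSpace.pi := by
    apply le_antisymm
    · have h1 : Measurable[MeasurableSpace.comap e MeasurableSpace.pi]
          (fun p : ProbabilityMeasure X => (p : Measure X)) := by
        let := MeasurableSpace.comap e MeasurableSpace.pi
        refine Measurable.measure_of_isPiSystem_of_isProbabilityMeasure hgen hpi fun A hA => ?_
        exact (measurable_pi_apply (⟨A, hA⟩ : generateSetAlgebra b)).comp
          (comap_measurable e)
      exact MeasurableSpace.comap_le_iff_le_map.2 h1
    · refine Measurable.comap_le (measurable_pi_lambda _ fun A => ?_)
      exact (Measure.measurable_coe (hmeas A A.2)).comp measurable_subtype_coe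
  have h2 := MeasurableSpace.CountablyGenerated.comap e
  rwa [← heq] at h2

lemma UnivMeasurable.aemeasurable_probabilityMeasure {α X : Type*} [MeasurableSpace α]
    [MeasurableSpace X] [MeasurableSpace.CountablyGenerated X] {P : α → ProbabilityMeasure X}
    (hP : UnivMeasurable fun ω => (P ω : Measure X)) (μ : Measure α) [IsProbabilityMeasure μ] :
    AEMeasurable P μ := by
  have h : NullMeasurable P μ := by
    rintro _ ⟨s, hs, rfl⟩
    exact (hP hs) μ inferInstance
  exact h.aemeasurable

/-- The Jankov–von Neumann theorem for sets of probability measures. -/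
lemma exists_univMeasurable_selection_toMeasure {X Y : Type*} [TopologicalSpace X] [PolishSpace X]
    [MeasurableSpace X] [BorelSpace X] [TopologicalSpace Y] [PolishSpace Y] [MeasurableSpace Y]
    [BorelSpace Y] {𝒬 : X → Set (ProbabilityMeasure Y)} (hne : ∀ ω, (𝒬 ω).Nonempty)
    (h𝒬 : AnalyticSet {p : X × ProbabilityMeasure Y | p.2 ∈ 𝒬 p.1}) :
    ∃ P : X → ProbabilityMeasure Y, UnivMeasurable (fun ω => (P ω : Measure Y)) ∧
      ∀ ω, P ω ∈ 𝒬 ω := by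
  rcases isEmpty_or_nonempty X with hX | ⟨⟨ω₀⟩⟩
  · exact ⟨fun ω => (hX.false ω).elim, (measurable_of_empty _).univMeasurable,
      fun ω => (hX.false ω).elim⟩
  rw [AnalyticSet] at h𝒬
  rcases h𝒬 with h𝒬 | ⟨g, hg, hrange⟩
  · obtain ⟨P, hP⟩ := hne ω₀
    exact (eq_empty_iff_forall_notMem.1 h𝒬 (ω₀, P) hP).elim
  let F : X → Set (ℕ → ℕ) := fun ω => {z | (g z).1 = ω}
  have hcl : ∀ ω, IsClosed (F ω) := fun ω => isClosed_eq (by fun_prop) continuous_const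
  have hFne : ∀ ω, (F ω).Nonempty := by
    intro ω
    obtain ⟨P, hP⟩ := hne ω
    have : (ω, P) ∈ range g := hrange ▸ hP
    obtain ⟨z, hz⟩ := this
    exact ⟨z, by simp [F, hz]⟩
  have hm : ∀ U, IsOpen U → MeasurableSet[univComp X] {ω | (F ω ∩ U).Nonempty} := by
    intro U hU
    have heq : {ω | (F ω ∩ U).Nonempty} = (fun z => (g z).1) '' U := by
      ext ω
      constructor
      · rintro ⟨z, hz, hzU⟩
        exact ⟨z, hzU, hz⟩
      · rintro ⟨z, hzU, hz⟩
        exact ⟨z, hz, hzU⟩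
    rw [heq]
    exact (hU.analyticSet_of_polishSpace.image_of_continuous
      (continuous_fst.comp hg)).univMeasurableSet
  obtain ⟨σ, hσ, hσF⟩ := @exists_measurable_selection X (ℕ → ℕ) (univComp X) _ _ _ _ F hcl hFne hm
  refine ⟨fun ω => (g (σ ω)).2, ?_, fun ω => ?_⟩
  · exact (continuous_snd.comp hg).measurable_toMeasure.comp hσ
  · have h : g (σ ω) ∈ {p : X × ProbabilityMeasure Y | p.2 ∈ 𝒬 p.1} := hrange ▸ mem_range_self _
    have h' : (g (σ ω)).2 ∈ 𝒬 (g (σ ω)).1 := h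
    have h1 : (g (σ ω)).1 = ω := hσF ω
    rwa [h1] at h'

section Step

variable {Ω₁ : Type*} [MeasurableSpace Ω₁] {t : ℕ}

lemma measurable_finSnoc :
    Measurable fun p : (Fin t → Ω₁) × Ω₁ => (Fin.snoc p.1 p.2 : Fin (t + 1) → Ω₁) := by
  refine measurable_pi_lambda _ fun i => ?_
  induction i using Fin.lastCases with
  | last => simpa using measurable_snd
  | cast i =>
    simp only [Fin.snoc_castSucc]
    exact (measurable_pi_apply i).comp measurable_fst

lemma measurable_finInit : Measurable fun ω : Fin (t + 1) → Ω₁ => (Fin.init ω : Fin t → Ω₁) :=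
  measurable_pi_lambda _ fun i => measurable_pi_apply i.castSucc

lemma measurable_finSnoc_right (ω : Fin t → Ω₁) :
    Measurable (Fin.snoc (α := fun _ => Ω₁) ω) :=
  measurable_finSnoc.comp measurable_prodMk_left

/-- The measure obtained from `ν` by appending one coordinate distributed according to `P`. -/
def appendMeasure (ν : Measure (Fin t → Ω₁)) (P : (Fin t → Ω₁) → Measure Ω₁) :
    Measure (Fin (t + 1) → Ω₁) :=
  ν.bind fun ω => (P ω).map (Fin.snoc ω)

variable [MeasurableSpace.CountablyGenerated Ω₁] {P : (Fin t → Ω₁) → ProbabilityMeasure Ω₁}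

lemma UnivMeasurable.aemeasurable_map_finSnoc (hP : UnivMeasurable fun ω => (P ω : Measure Ω₁))
    (ν : Measure (Fin t → Ω₁)) [IsProbabilityMeasure ν] :
    AEMeasurable
      (fun ω => (P ω : Measure Ω₁).map (Fin.snoc (α := fun _ => Ω₁) ω)) ν := by
  obtain ⟨P', hP'm, hP'⟩ := hP.aemeasurable_probabilityMeasure ν
  refine ⟨fun ω => (P' ω : Measure Ω₁).map (Fin.snoc (α := fun _ => Ω₁) ω), ?_, ?_⟩
  · refine Measure.measurable_of_measurable_coe _ fun s hs => ?_
    let κ : Kernel (Fin t → Ω₁) Ω₁ :=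
      ⟨fun ω => (P' ω : Measure Ω₁), measurable_subtype_coe.comp hP'm⟩
    have : IsMarkovKernel κ := ⟨fun ω => (P' ω).2⟩
    have h := Kernel.measurable_kernel_prodMk_left (κ := κ) (measurable_finSnoc hs)
    have heq : (fun ω => (P' ω : Measure Ω₁).map (Fin.snoc (α := fun _ => Ω₁) ω) s) =
        fun ω => κ ω (Prod.mk ω ⁻¹' ((fun p : (Fin t → Ω₁) × Ω₁ =>
          (Fin.snoc p.1 p.2 : Fin (t + 1) → Ω₁)) ⁻¹' s)) := by
      ext ω
      rw [Measure.map_apply (measurable_finSnoc_right ω) hs]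
      rfl
    rw [heq]
    exact h
  · filter_upwards [hP'] with ω hω
    rw [hω]

lemma appendMeasure_apply (hP : UnivMeasurable fun ω => (P ω : Measure Ω₁))
    (ν : Measure (Fin t → Ω₁)) [IsProbabilityMeasure ν] {s : Set (Fin (t + 1) → Ω₁)}
    (hs : MeasurableSet s) :
    appendMeasure ν (fun ω => (P ω : Measure Ω₁)) s =
      ∫⁻ ω, (P ω : Measure Ω₁) {x | (Fin.snoc ω x : Fin (t + 1) → Ω₁) ∈ s} ∂ν := by
  rw [appendMeasure, Measure.bind_apply hs (hP.aemeasurable_map_finSnoc ν)]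
  exact lintegral_congr fun ω => Measure.map_apply (measurable_finSnoc_right ω) hs

lemma map_init_appendMeasure (hP : UnivMeasurable fun ω => (P ω : Measure Ω₁))
    (ν : Measure (Fin t → Ω₁)) [IsProbabilityMeasure ν] :
    (appendMeasure ν fun ω => (P ω : Measure Ω₁)).map Fin.init = ν := by
  ext s hs
  rw [Measure.map_apply measurable_finInit hs,
    appendMeasure_apply hP ν (measurable_finInit hs), ← lintegral_indicator_one hs]
  refine lintegral_congr fun ω => ?_
  by_cases h : ω ∈ s <;> simp [h]

lemma isProbabilityMeasure_appendMeasure (hP : UnivMeasurable fun ω => (P ω : Measure Ω₁))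
    (ν : Measure (Fin t → Ω₁)) [IsProbabilityMeasure ν] :
    IsProbabilityMeasure (appendMeasure ν fun ω => (P ω : Measure Ω₁)) := by
  constructor
  rw [appendMeasure_apply hP ν MeasurableSet.univ]
  simp

lemma ae_appendMeasure (hP : UnivMeasurable fun ω => (P ω : Measure Ω₁))
    (ν : Measure (Fin t → Ω₁)) [IsProbabilityMeasure ν] {B : Set (Fin (t + 1) → Ω₁)}
    (hB : UnivMeasurableSet B)
    (h : ∀ᵐ ω ∂ν, ∀ᵐ x ∂(P ω : Measure Ω₁), (Fin.snoc ω x : Fin (t + 1) → Ω₁) ∈ B) :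
    ∀ᵐ ω ∂appendMeasure ν fun ω => (P ω : Measure Ω₁), ω ∈ B := by
  have := isProbabilityMeasure_appendMeasure hP ν
  obtain ⟨M, hMB, hM, hae⟩ :=
    (hB.nullMeasurableSet (appendMeasure ν fun ω => (P ω : Measure Ω₁))).compl
      |>.exists_measurable_subset_ae_eq
  have h0 : appendMeasure ν (fun ω => (P ω : Measure Ω₁)) M = 0 := by
    rw [appendMeasure_apply hP ν hM, lintegral_congr_ae (g := 0), lintegral_zero_fun]
    filter_upwards [h] with ω hω
    exact measure_mono_null (fun x hx => hMB hx) hω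
  rw [ae_iff]
  exact (measure_congr hae).symm.trans h0

end Step

/-- `p` holds outside a set that is null for every measure in `ProdSet 𝒬 t`. -/
def QuasiSurely {Ω₁ : Type*} [MeasurableSpace Ω₁]
    (𝒬 : (t : ℕ) → (Fin t → Ω₁) → Set (ProbabilityMeasure Ω₁)) (t : ℕ)
    (p : (Fin t → Ω₁) → Prop) : Prop :=
  ∀ μ ∈ ProdSet 𝒬 t, ∀ᵐ ω ∂μ, p ω

section ProdSet

variable {Ω₁ : Type*} [MeasurableSpace Ω₁]
  {𝒬 : (t : ℕ) → (Fin t → Ω₁) → Set (ProbabilityMeasure Ω₁)} {t : ℕ}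

namespace QuasiSurely

variable {p q : (Fin t → Ω₁) → Prop}

lemma mono (hp : QuasiSurely 𝒬 t p) (h : ∀ ω, p ω → q ω) : QuasiSurely 𝒬 t q :=
  fun μ hμ => (hp μ hμ).mono h

lemma and (hp : QuasiSurely 𝒬 t p) (hq : QuasiSurely 𝒬 t q) :
    QuasiSurely 𝒬 t fun ω => p ω ∧ q ω :=
  fun μ hμ => (hp μ hμ).and (hq μ hμ)

lemma of_forall (h : ∀ ω, p ω) : QuasiSurely 𝒬 t p :=
  fun _ _ => Eventually.of_forall h

end QuasiSurely

lemma exists_of_mem_prodSet_succ {μ : Measure (Fin (t + 1) → Ω₁)} (hμ : μ ∈ ProdSet 𝒬 (t + 1)) :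
    ∃ ν ∈ ProdSet 𝒬 t, ∃ P : (Fin t → Ω₁) → ProbabilityMeasure Ω₁,
      UnivMeasurable (fun ω => (P ω : Measure Ω₁)) ∧ (∀ ω, P ω ∈ 𝒬 t ω) ∧
        μ = appendMeasure ν fun ω => (P ω : Measure Ω₁) := by
  obtain ⟨P, hP, rfl⟩ := hμ
  exact ⟨_, ⟨P, fun s hs => hP s (hs.trans t.lt_succ_self), rfl⟩, P t, (hP t t.lt_succ_self).1,
    (hP t t.lt_succ_self).2, rfl⟩

lemma prodMeas_congr {P P' : (t : ℕ) → (Fin t → Ω₁) → Measure Ω₁} {T : ℕ}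
    (h : ∀ t, t < T → P t = P' t) : prodMeas P T = prodMeas P' T := by
  induction T with
  | zero => rfl
  | succ T ih =>
    rw [prodMeas, prodMeas, ih fun t ht => h t (ht.trans T.lt_succ_self), h T T.lt_succ_self]

lemma appendMeasure_mem_prodSet {ν : Measure (Fin t → Ω₁)} (hν : ν ∈ ProdSet 𝒬 t)
    {P : (Fin t → Ω₁) → ProbabilityMeasure Ω₁}
    (hP : UnivMeasurable fun ω => (P ω : Measure Ω₁)) (hP𝒬 : ∀ ω, P ω ∈ 𝒬 t ω) :
    (appendMeasure ν fun ω => (P ω : Measure Ω₁)) ∈ ProdSet 𝒬 (t + 1) := by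
  classical
  obtain ⟨R, hR, rfl⟩ := hν
  refine ⟨Function.update R t P, fun s hs => ?_, ?_⟩
  · rcases Nat.lt_succ_iff_lt_or_eq.1 hs with h | rfl
    · rw [Function.update_of_ne h.ne]
      exact hR s h
    · rw [Function.update_self]
      exact ⟨hP, hP𝒬⟩
  · rw [prodMeas, prodMeas_congr (P := fun s ω => (Function.update R t P s ω : Measure Ω₁))
      (P' := fun s ω => (R s ω : Measure Ω₁)), Function.update_self]
    · rfl
    · intro s hs
      rw [Function.update_of_ne hs.ne]

variable [MeasurableSpace.CountablyGenerated Ω₁]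

lemma isProbabilityMeasure_of_mem_prodSet {μ : Measure (Fin t → Ω₁)} (hμ : μ ∈ ProdSet 𝒬 t) :
    IsProbabilityMeasure μ := by
  obtain ⟨P, hP, rfl⟩ := hμ
  induction t with
  | zero => exact Measure.dirac.isProbabilityMeasure
  | succ t ih =>
    have := ih fun s hs => hP s (hs.trans t.lt_succ_self)
    exact isProbabilityMeasure_appendMeasure (hP t t.lt_succ_self).1 _

namespace QuasiSurely

lemma comp_init {p : (Fin t → Ω₁) → Prop} (hp : QuasiSurely 𝒬 t p) :
    QuasiSurely 𝒬 (t + 1) fun ω => p (Fin.init ω) := by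
  intro μ hμ
  obtain ⟨ν, hν, P, hP, -, rfl⟩ := exists_of_mem_prodSet_succ hμ
  have := isProbabilityMeasure_of_mem_prodSet hν
  have h := hp ν hν
  rw [← map_init_appendMeasure hP ν] at h
  exact ae_of_ae_map measurable_finInit.aemeasurable h

lemma of_snoc {B : Set (Fin (t + 1) → Ω₁)} (hB : UnivMeasurableSet B)
    (h : QuasiSurely 𝒬 t fun ω => ∀ P ∈ 𝒬 t ω, ∀ᵐ x ∂(P : Measure Ω₁),
      (Fin.snoc ω x : Fin (t + 1) → Ω₁) ∈ B) :
    QuasiSurely 𝒬 (t + 1) fun ω => ω ∈ B := by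
  intro μ hμ
  obtain ⟨ν, hν, P, hP, hP𝒬, rfl⟩ := exists_of_mem_prodSet_succ hμ
  have := isProbabilityMeasure_of_mem_prodSet hν
  refine ae_appendMeasure hP ν hB ?_
  filter_upwards [h ν hν] with ω hω using hω _ (hP𝒬 ω)

lemma of_comp_init
    (hsel : ∃ P : (Fin t → Ω₁) → ProbabilityMeasure Ω₁,
      UnivMeasurable (fun ω => (P ω : Measure Ω₁)) ∧ ∀ ω, P ω ∈ 𝒬 t ω)
    {p : (Fin t → Ω₁) → Prop} (hpm : UnivMeasurableSet {ω | p ω})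
    (hp : QuasiSurely 𝒬 (t + 1) fun ω => p (Fin.init ω)) : QuasiSurely 𝒬 t p := by
  intro ν hν
  obtain ⟨P, hP, hP𝒬⟩ := hsel
  have := isProbabilityMeasure_of_mem_prodSet hν
  have h := hp _ (appendMeasure_mem_prodSet hν hP hP𝒬)
  have hmap := map_init_appendMeasure hP ν
  rw [ae_iff] at h ⊢
  have hnull : NullMeasurableSet {ω | ¬ p ω}
      ((appendMeasure ν fun ω => (P ω : Measure Ω₁)).map Fin.init) := by
    rw [hmap]
    exact (hpm.nullMeasurableSet ν).compl
  have happly := Measure.map_apply₀ measurable_finInit.aemeasurable hnull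
  rw [hmap] at happly
  exact happly.trans h

lemma comp_castLE {s : ℕ} (hst : s ≤ t) {p : (Fin s → Ω₁) → Prop} (hp : QuasiSurely 𝒬 s p) :
    QuasiSurely 𝒬 t fun ω => p fun i => ω (Fin.castLE hst i) := by
  induction t, hst using Nat.le_induction with
  | base => exact hp
  | succ t hst ih => exact ih.comp_init

lemma of_comp_castLE {s T : ℕ} (hst : s ≤ t) (htT : t ≤ T)
    (hsel : ∀ r, r < T → ∃ P : (Fin r → Ω₁) → ProbabilityMeasure Ω₁,
      UnivMeasurable (fun ω => (P ω : Measure Ω₁)) ∧ ∀ ω, P ω ∈ 𝒬 r ω)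
    {p : (Fin s → Ω₁) → Prop} (hpm : UnivMeasurableSet {ω | p ω})
    (hp : QuasiSurely 𝒬 t fun ω => p fun i => ω (Fin.castLE hst i)) : QuasiSurely 𝒬 s p := by
  induction t, hst using Nat.le_induction with
  | base => exact hp
  | succ t hst ih =>
    refine ih (t.le_succ.trans htT) (of_comp_init (hsel t htT) ?_ hp)
    exact (measurable_pi_lambda _ fun i => measurable_pi_apply _ :
      Measurable fun (ω : Fin t → Ω₁) (i : Fin s) => ω (Fin.castLE hst i)).univComp_univComp hpm

end QuasiSurely

end ProdSet

/-- A closed convex cone in `ℝ^d` containing the origin. -/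
structure IsClosedConvexCone {d : ℕ} (C : Set (Fin d → ℝ)) : Prop where
  isClosed : IsClosed C
  convex : Convex ℝ C
  zero_mem : (0 : Fin d → ℝ) ∈ C
  smul_mem : ∀ c : ℝ, 0 ≤ c → ∀ x ∈ C, c • x ∈ C

section Cone

variable {d : ℕ} {C K S : Set (Fin d → ℝ)}

lemma IsClosedConvexCone.add_mem (hC : IsClosedConvexCone C) {x y : Fin d → ℝ} (hx : x ∈ C)
    (hy : y ∈ C) : x + y ∈ C := by
  have h := hC.smul_mem 2 (by norm_num) _
    (hC.convex hx hy (a := 1 / 2) (b := 1 / 2) (by norm_num) (by norm_num) (by norm_num))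
  have heq : (2 : ℝ) • ((1 / 2 : ℝ) • x + (1 / 2 : ℝ) • y) = x + y := by
    rw [smul_add, smul_smul, smul_smul]; norm_num
  rwa [heq] at h

lemma isClosedConvexCone_dualCone (S : Set (Fin d → ℝ)) : IsClosedConvexCone (dualCone S) where
  isClosed := by
    simp only [dualCone, ofPred_forall]
    exact isClosed_biInter fun x _ => isClosed_le continuous_const (by fun_prop)
  convex := by
    intro y hy z hz a b ha hb _ x hx
    have h1 : ∑ i, x i * (a • y + b • z) i = a * ∑ i, x i * y i + b * ∑ i, x i * z i := by
      simp only [Pi.add_apply, Pi.smul_apply, smul_eq_mul, Finset.mul_sum, ← Finset.sum_add_distrib]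
      exact Finset.sum_congr rfl fun i _ => by ring
    rw [h1]
    exact add_nonneg (mul_nonneg ha (hy x hx)) (mul_nonneg hb (hz x hx))
  zero_mem := fun x _ => by simp
  smul_mem := by
    intro c hc y hy x hx
    have h1 : ∑ i, x i * (c • y) i = c * ∑ i, x i * y i := by
      simp only [Pi.smul_apply, smul_eq_mul, Finset.mul_sum]
      exact Finset.sum_congr rfl fun i _ => by ring
    rw [h1]
    exact mul_nonneg hc (hy x hx)

lemma dualCone_anti (h : S ⊆ C) : dualCone C ⊆ dualCone S :=
  fun _ hy x hx => hy x (h hx)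

lemma subset_dualCone_dualCone : S ⊆ dualCone (dualCone S) := by
  intro x hx y hy
  simp only [mul_comm (y _)]
  exact hy x hx

lemma IsClosedConvexCone.exists_mem_dualCone_lt_zero (hC : IsClosedConvexCone C) {x : Fin d → ℝ}
    (hx : x ∉ C) : ∃ y ∈ dualCone C, ∑ i, x i * y i < 0 := by
  obtain ⟨f, u, hfx, hu⟩ := geometric_hahn_banach_point_closed hC.convex hC.isClosed hx
  have hsum : ∀ z : Fin d → ℝ, ∑ i, z i * f (Pi.single i 1) = f z := by
    intro z
    conv_rhs => rw [pi_eq_sum_univ' z, map_sum]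
    exact Finset.sum_congr rfl fun i _ => by simp
  have hu0 : u < 0 := by simpa using hu 0 hC.zero_mem
  refine ⟨fun i => f (Pi.single i 1), fun z hz => ?_, ?_⟩
  · rw [hsum]
    by_contra! hneg
    have h1 := hu _ (hC.smul_mem (u / f z) (div_nonneg_of_nonpos hu0.le hneg.le) z hz)
    rw [map_smul, smul_eq_mul, div_mul_cancel₀ _ hneg.ne] at h1
    exact h1.false
  · rw [hsum]
    exact hfx.trans hu0

lemma IsClosedConvexCone.dualCone_dualCone (hC : IsClosedConvexCone C) :
    dualCone (dualCone C) = C := by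
  refine subset_antisymm (fun x hx => ?_) subset_dualCone_dualCone
  by_contra hxC
  obtain ⟨y, hy, hlt⟩ := hC.exists_mem_dualCone_lt_zero hxC
  have h := hx y hy
  simp only [mul_comm (y _)] at h
  exact absurd hlt h.not_gt

lemma eq_zero_of_interior_dualCone_nonempty (h : (interior (dualCone K)).Nonempty)
    {x : Fin d → ℝ} (hx : x ∈ K) (hx' : -x ∈ K) : x = 0 := by
  obtain ⟨y, hy⟩ := h
  have hpair : ∀ z ∈ dualCone K, ∑ i, x i * z i = 0 := by
    intro z hz
    have h1 := hz x hx
    have h2 := hz (-x) hx'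
    simp only [Pi.neg_apply, neg_mul, Finset.sum_neg_distrib] at h2
    linarith
  have hev : ∀ᶠ t : ℝ in 𝓝 0, y + t • x ∈ dualCone K := by
    have hc : Continuous fun t : ℝ => y + t • x := by fun_prop
    have : Tendsto (fun t : ℝ => y + t • x) (𝓝 0) (𝓝 y) := by simpa using hc.tendsto 0
    exact this (mem_interior_iff_mem_nhds.1 hy)
  obtain ⟨t, ht, ht0⟩ := ((hev.filter_mono nhdsWithin_le_nhds).and
    (self_mem_nhdsWithin : Ioi (0 : ℝ) ∈ 𝓝[>] 0)).exists
  have h1 := hpair _ ht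
  have h2 := hpair _ (interior_subset hy)
  have h3 : ∑ i, x i * (y + t • x) i = ∑ i, x i * y i + t * ∑ i, x i * x i := by
    simp only [Pi.add_apply, Pi.smul_apply, smul_eq_mul, Finset.mul_sum, ← Finset.sum_add_distrib]
    exact Finset.sum_congr rfl fun i _ => by ring
  rw [h3, h2, zero_add] at h1
  have h4 : ∑ i, x i * x i = 0 := (mul_eq_zero.1 h1).resolve_left (ne_of_gt ht0)
  ext i
  exact mul_self_eq_zero.1
    ((Finset.sum_eq_zero_iff_of_nonneg fun i _ => mul_self_nonneg (x i)).1 h4 i (Finset.mem_univ i))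

lemma IsClosedConvexCone.exists_norm_le_mul_norm_add {N : Set (Fin d → ℝ)}
    (hK : IsClosedConvexCone K) (hN : IsClosedConvexCone N)
    (h : ∀ x ∈ K, -x ∈ N → x = 0) :
    ∃ δ : ℝ, 0 < δ ∧ ∀ x ∈ K, ∀ y ∈ N, δ * ‖x‖ ≤ ‖x + y‖ := by
  have hcomp : IsCompact (K ∩ Metric.sphere 0 1) := (isCompact_sphere 0 1).inter_left hK.isClosed
  have hNne : (-N).Nonempty := ⟨0, by simpa using hN.zero_mem⟩
  have hNcl : IsClosed (-N) := hN.isClosed.neg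
  rcases (K ∩ Metric.sphere 0 1).eq_empty_or_nonempty with he | hne
  · refine ⟨1, one_pos, fun x hx y hy => ?_⟩
    have hx0 : x = 0 := by
      by_contra hx0
      have : ‖x‖⁻¹ • x ∈ K ∩ Metric.sphere 0 1 :=
        ⟨hK.smul_mem _ (by positivity) x hx, by
          rw [mem_sphere_zero_iff_norm, norm_smul, norm_inv, norm_norm,
            inv_mul_cancel₀ (norm_ne_zero_iff.2 hx0)]⟩
      rw [he] at this
      exact this
    simp [hx0]
  · obtain ⟨x₀, hx₀, hmin⟩ := hcomp.exists_isMinOn hne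
      (Metric.continuous_infDist_pt (-N)).continuousOn
    have hpos : 0 < Metric.infDist x₀ (-N) := by
      rw [← hNcl.notMem_iff_infDist_pos hNne]
      intro hmem
      have h0 := h x₀ hx₀.1 hmem
      have h1 := mem_sphere_zero_iff_norm.1 hx₀.2
      rw [h0, norm_zero] at h1
      exact zero_ne_one h1
    refine ⟨_, hpos, fun x hx y hy => ?_⟩
    by_cases hx0 : x = 0
    · simp [hx0]
    have hn : 0 < ‖x‖ := norm_pos_iff.2 hx0
    have hmem : ‖x‖⁻¹ • x ∈ K ∩ Metric.sphere 0 1 :=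
      ⟨hK.smul_mem _ (by positivity) x hx, by
        rw [mem_sphere_zero_iff_norm, norm_smul, norm_inv, norm_norm, inv_mul_cancel₀ hn.ne']⟩
    have h1 : Metric.infDist x₀ (-N) ≤ dist (‖x‖⁻¹ • x) (-(‖x‖⁻¹ • y)) :=
      (hmin hmem).trans (Metric.infDist_le_dist_of_mem (by
        simpa using hN.smul_mem _ (by positivity) y hy))
    rw [dist_eq_norm, sub_neg_eq_add, ← smul_add, norm_smul, norm_inv, norm_norm,
      le_inv_mul_iff₀ hn] at h1
    linarith

lemma IsClosedConvexCone.add {N : Set (Fin d → ℝ)} (hK : IsClosedConvexCone K)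
    (hN : IsClosedConvexCone N) (h : ∀ x ∈ K, -x ∈ N → x = 0) : IsClosedConvexCone (K + N) where
  isClosed := by
    obtain ⟨δ, hδ, hKN⟩ := hK.exists_norm_le_mul_norm_add hN h
    refine isClosed_of_closure_subset fun z hz => ?_
    have hcl : IsClosed ((Metric.closedBall 0 ((‖z‖ + 1) / δ) ∩ K) + N) :=
      hN.isClosed.add_left_of_isCompact ((isCompact_closedBall 0 _).inter_right hK.isClosed)
    have hz' : z ∈ closure ((K + N) ∩ Metric.ball z 1) :=
      Metric.isOpen_ball.closure_inter ⟨hz, Metric.mem_ball_self one_pos⟩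
    have hsub : (K + N) ∩ Metric.ball z 1 ⊆ (Metric.closedBall 0 ((‖z‖ + 1) / δ) ∩ K) + N := by
      rintro _ ⟨⟨x, hx, y, hy, rfl⟩, hb⟩
      refine ⟨x, ⟨?_, hx⟩, y, hy, rfl⟩
      rw [mem_closedBall_zero_iff, le_div_iff₀ hδ]
      have h1 := hKN x hx y hy
      have h2 : ‖x + y‖ ≤ ‖z‖ + ‖x + y - z‖ := norm_le_insert' _ _
      rw [Metric.mem_ball, dist_eq_norm] at hb
      linarith
    exact add_subset_add_right inter_subset_right (closure_minimal hsub hcl hz')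
  convex := hK.convex.add hN.convex
  zero_mem := ⟨0, hK.zero_mem, 0, hN.zero_mem, add_zero 0⟩
  smul_mem := by
    rintro c hc _ ⟨x, hx, y, hy, rfl⟩
    exact ⟨c • x, hK.smul_mem c hc x hx, c • y, hN.smul_mem c hc y hy, (smul_add c x y).symm⟩

lemma isClosedConvexCone_closure_convexHull (h0 : (0 : Fin d → ℝ) ∈ S)
    (hS : ∀ c : ℝ, 0 ≤ c → ∀ x ∈ S, c • x ∈ S) :
    IsClosedConvexCone (closure (convexHull ℝ S)) where
  isClosed := isClosed_closure
  convex := (convex_convexHull ℝ S).closure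
  zero_mem := subset_closure (subset_convexHull ℝ S h0)
  smul_mem := by
    intro c hc x hx
    have h1 : MapsTo (fun x => c • x) (convexHull ℝ S) (convexHull ℝ S) := by
      intro z hz
      have h2 : c • z ∈ c • convexHull ℝ S := smul_mem_smul_set hz
      rw [← convexHull_smul] at h2
      refine convexHull_mono ?_ h2
      rintro _ ⟨w, hw, rfl⟩
      exact hS c hc w hw
    exact h1.closure (continuous_const_smul c) hx

lemma IsClosedConvexCone.exists_sub_mem_dualCone (hK : IsClosedConvexCone K)
    (h0 : (0 : Fin d → ℝ) ∈ S) (hS : ∀ c : ℝ, 0 ≤ c → ∀ x ∈ S, c • x ∈ S)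
    (h : ∀ x ∈ K, -x ∈ dualCone S → x = 0) {x : Fin d → ℝ}
    (hx : x ∈ dualCone (dualCone K ∩ closure (convexHull ℝ S))) :
    ∃ k ∈ K, x - k ∈ dualCone S := by
  have hN := isClosedConvexCone_dualCone S
  suffices hmem : x ∈ K + dualCone S by
    obtain ⟨k, hk, n, hn, rfl⟩ := hmem
    exact ⟨k, hk, by simpa using hn⟩
  by_contra hmem
  obtain ⟨y, hy, hlt⟩ := (hK.add hN h).exists_mem_dualCone_lt_zero hmem
  have hyK : y ∈ dualCone K :=
    dualCone_anti (fun k hk => mem_add.2 ⟨k, hk, 0, hN.zero_mem, add_zero k⟩) hy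
  have hyN : y ∈ dualCone (dualCone S) :=
    dualCone_anti (fun n hn => mem_add.2 ⟨0, hK.zero_mem, n, hn, zero_add n⟩) hy
  have hyS : y ∈ closure (convexHull ℝ S) := by
    rw [← (isClosedConvexCone_closure_convexHull h0 hS).dualCone_dualCone]
    exact dualCone_anti
      (dualCone_anti ((subset_convexHull ℝ S).trans subset_closure)) hyN
  have h1 := hx y ⟨hyK, hyS⟩
  simp only [mul_comm (y _)] at h1
  exact absurd hlt h1.not_gt

lemma IsClosedConvexCone.interior_nonempty (hC : IsClosedConvexCone C)
    (h : ∀ x ∈ dualCone C, -x ∈ dualCone C → x = 0) : (interior C).Nonempty := by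
  rw [hC.convex.interior_nonempty_iff_affineSpan_eq_top]
  by_contra hspan
  have hne : Submodule.span ℝ C ≠ ⊤ := by
    intro htop
    apply hspan
    rw [← AffineSubspace.coe_eq_univ_iff, ← insert_eq_of_mem hC.zero_mem, affineSpan_insert_zero,
      htop, Submodule.top_coe]
  obtain ⟨f, hf, hker⟩ := Submodule.exists_le_ker_of_lt_top _ (lt_top_iff_ne_top.2 hne)
  have hsum : ∀ z : Fin d → ℝ, ∑ i, z i * f (Pi.single i 1) = f z := by
    intro z
    conv_rhs => rw [pi_eq_sum_univ' z, map_sum]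
    exact Finset.sum_congr rfl fun i _ => by simp
  have h0 : ∀ x ∈ C, f x = 0 := fun x hx => hker (Submodule.subset_span hx)
  have hz := h (fun i => f (Pi.single i 1)) (fun x hx => by rw [hsum, h0 x hx])
    (fun x hx => by
      simp only [Pi.neg_apply, mul_neg, Finset.sum_neg_distrib]
      rw [hsum, h0 x hx, neg_zero])
  refine hf (LinearMap.ext fun z => ?_)
  rw [← hsum z, LinearMap.zero_apply]
  exact Finset.sum_eq_zero fun i _ => by rw [congrFun hz i, Pi.zero_apply, mul_zero]

end Cone

lemma IsClosedConvexCone.inter {d : ℕ} {C C' : Set (Fin d → ℝ)} (hC : IsClosedConvexCone C)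
    (hC' : IsClosedConvexCone C') : IsClosedConvexCone (C ∩ C') where
  isClosed := hC.isClosed.inter hC'.isClosed
  convex := hC.convex.inter hC'.convex
  zero_mem := ⟨hC.zero_mem, hC'.zero_mem⟩
  smul_mem := fun c hc x hx => ⟨hC.smul_mem c hc x hx.1, hC'.smul_mem c hc x hx.2⟩

lemma IsClosedConvexCone.eq_zero_of_inter_sphere_eq_empty {d : ℕ} {K N : Set (Fin d → ℝ)}
    (hK : IsClosedConvexCone K) (hN : IsClosedConvexCone N)
    (h : ¬ (K ∩ {x | -x ∈ N} ∩ Metric.sphere 0 1).Nonempty) {x : Fin d → ℝ} (hx : x ∈ K)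
    (hx' : -x ∈ N) : x = 0 := by
  by_contra hx0
  refine h ⟨‖x‖⁻¹ • x, ⟨hK.smul_mem _ (by positivity) x hx, ?_⟩, ?_⟩
  · rw [mem_ofPred_eq, ← smul_neg]
    exact hN.smul_mem _ (by positivity) _ hx'
  · rw [mem_sphere_zero_iff_norm, norm_smul, norm_inv, norm_norm,
      inv_mul_cancel₀ (norm_ne_zero_iff.2 hx0)]

section Support

variable {α : Type*} [MeasurableSpace α] {d : ℕ} {𝒬 : Set (ProbabilityMeasure α)}
  {C : α → Set (Fin d → ℝ)}

lemma zero_mem_svSupport (h𝒬 : 𝒬.Nonempty) (h0 : ∀ x, 0 ∈ C x) : 0 ∈ svSupport 𝒬 C := by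
  rintro F ⟨-, hF⟩
  obtain ⟨P, hP⟩ := h𝒬
  have hne : {x | C x ⊆ F}.Nonempty := nonempty_of_measure_ne_zero (μ := (P : Measure α)) (by
    rw [hF P hP]; exact one_ne_zero)
  obtain ⟨x, hx⟩ := hne
  exact hx (h0 x)

lemma smul_mem_svSupport (hC : ∀ x, ∀ c : ℝ, 0 ≤ c → ∀ y ∈ C x, c • y ∈ C x) {c : ℝ}
    (hc : 0 ≤ c) {y : Fin d → ℝ} (hy : y ∈ svSupport 𝒬 C) : c • y ∈ svSupport 𝒬 C := by
  rintro F ⟨hF, hFP⟩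
  refine hy ((fun z => c • z) ⁻¹' F) ⟨hF.preimage (continuous_const_smul c), fun P hP => ?_⟩
  refine le_antisymm prob_le_one ?_
  rw [← hFP P hP]
  exact measure_mono fun x hx z hz => hx (hC x c hc z hz)

end Support

/-- The standing assumptions on the one-step models and on the solvency cones. -/
structure IsConeMarket {Ω₁ : Type*} [TopologicalSpace Ω₁] [PolishSpace Ω₁] [MeasurableSpace Ω₁]
    [BorelSpace Ω₁] {d : ℕ} (𝒬 : (t : ℕ) → (Fin t → Ω₁) → Set (ProbabilityMeasure Ω₁))
    (K : (t : ℕ) → (Fin t → Ω₁) → Set (Fin d → ℝ)) (T : ℕ) : Prop where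
  nonempty : ∀ t, t < T → ∀ ω, (𝒬 t ω).Nonempty
  analyticSet : ∀ t, t < T →
    AnalyticSet {p : (Fin t → Ω₁) × ProbabilityMeasure Ω₁ | p.2 ∈ 𝒬 t p.1}
  cone : ∀ t, t ≤ T → ∀ ω, IsClosedConvexCone (K t ω)
  analyticSet_dualCone : ∀ t, t ≤ T →
    AnalyticSet {p : (Fin t → Ω₁) × (Fin d → ℝ) | p.2 ∈ dualCone (K t p.1)}

/-- The conditional support of the next value of `L`. -/
def nextSupport {Ω₁ : Type*} [MeasurableSpace Ω₁] {d : ℕ}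
    (𝒬 : (t : ℕ) → (Fin t → Ω₁) → Set (ProbabilityMeasure Ω₁))
    (L : (t : ℕ) → (Fin t → Ω₁) → Set (Fin d → ℝ)) (t : ℕ) (ω : Fin t → Ω₁) :
    Set (Fin d → ℝ) :=
  svSupport (𝒬 t ω) fun ω' => L (t + 1) (Fin.snoc ω ω')

/-- `L` is obtained from the dual cones of `K` by the backward recursion. -/
structure IsBackwardRecursion {Ω₁ : Type*} [MeasurableSpace Ω₁] {d : ℕ}
    (𝒬 : (t : ℕ) → (Fin t → Ω₁) → Set (ProbabilityMeasure Ω₁))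
    (K L : (t : ℕ) → (Fin t → Ω₁) → Set (Fin d → ℝ)) (T : ℕ) : Prop where
  terminal : ∀ ω, L T ω = dualCone (K T ω)
  step : ∀ t, t < T → ∀ ω,
    L t ω = dualCone (K t ω) ∩ closure (convexHull ℝ (nextSupport 𝒬 L t ω))

section Polish

variable {Ω₁ : Type*} [TopologicalSpace Ω₁] [PolishSpace Ω₁] [MeasurableSpace Ω₁]
  [BorelSpace Ω₁] {T d t : ℕ} {𝒬 : (t : ℕ) → (Fin t → Ω₁) → Set (ProbabilityMeasure Ω₁)}
  {K L : (t : ℕ) → (Fin t → Ω₁) → Set (Fin d → ℝ)}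

namespace IsConeMarket

lemma exists_selection (hM : IsConeMarket 𝒬 K T) (ht : t < T) :
    ∃ P : (Fin t → Ω₁) → ProbabilityMeasure Ω₁,
      UnivMeasurable (fun ω => (P ω : Measure Ω₁)) ∧ ∀ ω, P ω ∈ 𝒬 t ω :=
  exists_univMeasurable_selection_toMeasure (hM.nonempty t ht) (hM.analyticSet t ht)

lemma isCaratheodorySet (hM : IsConeMarket 𝒬 K T) (ht : t ≤ T) :
    @IsCaratheodorySet _ (univComp _) d (K t) := by
  have h := isCaratheodorySet_dualCone (C := fun ω => dualCone (K t ω))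
    (hM.analyticSet_dualCone t ht) (fun ω => (isClosedConvexCone_dualCone _).zero_mem)
    fun ω => (isClosedConvexCone_dualCone _).smul_mem
  have heq : (fun ω => dualCone (dualCone (K t ω))) = K t :=
    funext fun ω => (hM.cone t ht ω).dualCone_dualCone
  rwa [heq] at h

end IsConeMarket

namespace IsBackwardRecursion

lemma cone_and_analyticSet (hL : IsBackwardRecursion 𝒬 K L T) (hM : IsConeMarket 𝒬 K T)
    (ht : t ≤ T) : (∀ ω, IsClosedConvexCone (L t ω)) ∧
      AnalyticSet {p : (Fin t → Ω₁) × (Fin d → ℝ) | p.2 ∈ L t p.1} := by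
  obtain ⟨n, hn⟩ := Nat.exists_eq_add_of_le ht
  induction n generalizing t with
  | zero =>
    obtain rfl : T = t := by simpa using hn
    simp only [hL.terminal]
    exact ⟨fun ω => isClosedConvexCone_dualCone _, hM.analyticSet_dualCone T le_rfl⟩
  | succ n ih =>
    have htT : t < T := by omega
    obtain ⟨hc, ha⟩ := ih (t := t + 1) htT (by omega)
    simp only [hL.step t htT]
    refine ⟨fun ω => (isClosedConvexCone_dualCone _).inter
      (isClosedConvexCone_closure_convexHull
        (zero_mem_svSupport (hM.nonempty t htT ω) fun x => (hc _).zero_mem)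
        fun c h0 x hx => smul_mem_svSupport (fun x => (hc _).smul_mem) h0 hx), ?_⟩
    have hS : AnalyticSet {p : (Fin t → Ω₁) × (Fin d → ℝ) | p.2 ∈ nextSupport 𝒬 L t p.1} := by
      refine analyticSet_setOf_mem_svSupport (C := fun ω ω' => L (t + 1) (Fin.snoc ω ω'))
        (hM.analyticSet t htT) (ha.preimage
          (f := fun p : ((Fin t → Ω₁) × Ω₁) × (Fin d → ℝ) => (Fin.snoc p.1.1 p.1.2, p.2)) ?_)
      exact (Continuous.finSnoc (A := fun _ => Ω₁) (by fun_prop) (by fun_prop)).prodMk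
        continuous_snd
    exact (hM.analyticSet_dualCone t ht).inter
      (analyticSet_setOf_mem_closure (S := fun ω => convexHull ℝ (nextSupport 𝒬 L t ω))
        (analyticSet_setOf_mem_convexHull (S := fun ω => nextSupport 𝒬 L t ω) hS))

lemma cone (hL : IsBackwardRecursion 𝒬 K L T) (hM : IsConeMarket 𝒬 K T) (ht : t ≤ T)
    (ω : Fin t → Ω₁) : IsClosedConvexCone (L t ω) :=
  (hL.cone_and_analyticSet hM ht).1 ω

lemma isCaratheodorySet (hL : IsBackwardRecursion 𝒬 K L T) (hM : IsConeMarket 𝒬 K T)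
    (ht : t ≤ T) : @IsCaratheodorySet _ (univComp _) d fun ω => dualCone (L t ω) :=
  isCaratheodorySet_dualCone (hL.cone_and_analyticSet hM ht).2
    (fun ω => (hL.cone hM ht ω).zero_mem) fun ω => (hL.cone hM ht ω).smul_mem

lemma analyticSet_snoc (hL : IsBackwardRecursion 𝒬 K L T) (hM : IsConeMarket 𝒬 K T)
    (ht : t < T) : AnalyticSet {p : ((Fin t → Ω₁) × Ω₁) × (Fin d → ℝ) |
      p.2 ∈ L (t + 1) (Fin.snoc p.1.1 p.1.2)} := by
  refine (hL.cone_and_analyticSet hM ht).2.preimage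
    (f := fun p : ((Fin t → Ω₁) × Ω₁) × (Fin d → ℝ) => (Fin.snoc p.1.1 p.1.2, p.2)) ?_
  exact (Continuous.finSnoc (A := fun _ => Ω₁) (by fun_prop) (by fun_prop)).prodMk continuous_snd

lemma zero_mem_nextSupport (hL : IsBackwardRecursion 𝒬 K L T) (hM : IsConeMarket 𝒬 K T)
    (ht : t < T) (ω : Fin t → Ω₁) : 0 ∈ nextSupport 𝒬 L t ω :=
  zero_mem_svSupport (hM.nonempty t ht ω) fun _ => (hL.cone hM ht _).zero_mem

lemma smul_mem_nextSupport (hL : IsBackwardRecursion 𝒬 K L T) (hM : IsConeMarket 𝒬 K T)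
    (ht : t < T) (ω : Fin t → Ω₁) (c : ℝ) (hc : 0 ≤ c) (x : Fin d → ℝ)
    (hx : x ∈ nextSupport 𝒬 L t ω) : c • x ∈ nextSupport 𝒬 L t ω :=
  smul_mem_svSupport (fun _ => (hL.cone hM ht _).smul_mem) hc hx

lemma isCaratheodorySet_dualCone_nextSupport (hL : IsBackwardRecursion 𝒬 K L T)
    (hM : IsConeMarket 𝒬 K T) (ht : t < T) :
    @IsCaratheodorySet _ (univComp _) d fun ω => dualCone (nextSupport 𝒬 L t ω) :=
  isCaratheodorySet_dualCone (C := fun ω => nextSupport 𝒬 L t ω)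
    (analyticSet_setOf_mem_svSupport (C := fun ω ω' => L (t + 1) (Fin.snoc ω ω'))
      (hM.analyticSet t ht) (hL.analyticSet_snoc hM ht))
    (hL.zero_mem_nextSupport hM ht) (hL.smul_mem_nextSupport hM ht)

lemma ae_subset_nextSupport (hL : IsBackwardRecursion 𝒬 K L T) (hM : IsConeMarket 𝒬 K T)
    (ht : t < T) (ω : Fin t → Ω₁) {P : ProbabilityMeasure Ω₁} (hP : P ∈ 𝒬 t ω) :
    ∀ᵐ x ∂(P : Measure Ω₁), L (t + 1) (Fin.snoc ω x) ⊆ nextSupport 𝒬 L t ω :=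
  ae_subset_svSupport (C := fun ω' => L (t + 1) (Fin.snoc ω ω'))
    (fun _ hU Q _ => nullMeasurableSet_section_inter_nonempty
      (C := fun ω ω' => L (t + 1) (Fin.snoc ω ω')) (hL.analyticSet_snoc hM ht) hU ω Q) hP

end IsBackwardRecursion

end Polish

/-- The value at time `t` of the sum of the adapted positions `k 0, …, k t`. -/
def partialSum {Ω₁ : Type*} {d : ℕ} (k : (t : ℕ) → (Fin t → Ω₁) → Fin d → ℝ) :
    (t : ℕ) → (Fin t → Ω₁) → Fin d → ℝ
  | 0, ω => k 0 ω
  | t + 1, ω => partialSum k t (Fin.init ω) + k (t + 1) ω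

lemma partialSum_eq_sum {Ω₁ : Type*} {d : ℕ} (k : (t : ℕ) → (Fin t → Ω₁) → Fin d → ℝ) (t : ℕ)
    (ω : Fin t → Ω₁) : partialSum k t ω = ∑ s ∈ Finset.range (t + 1),
      if hs : s ≤ t then k s (fun i => ω (Fin.castLE hs i)) else 0 := by
  induction t with
  | zero => simp [partialSum]
  | succ t ih =>
    rw [Finset.sum_range_succ, dif_pos le_rfl, partialSum, ih]
    congr 1
    refine Finset.sum_congr rfl fun s hs => ?_
    have hst : s ≤ t := Nat.lt_succ_iff.1 (Finset.mem_range.1 hs)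
    rw [dif_pos hst, dif_pos (hst.trans t.le_succ)]
    rfl

lemma partialSum_add {Ω₁ : Type*} {d : ℕ} (k l : (t : ℕ) → (Fin t → Ω₁) → Fin d → ℝ) (t : ℕ)
    (ω : Fin t → Ω₁) :
    partialSum (fun s ω => k s ω + l s ω) t ω = partialSum k t ω + partialSum l t ω := by
  induction t with
  | zero => rfl
  | succ t ih => simp only [partialSum, ih]; abel

lemma UnivMeasurable.add {α : Type*} [MeasurableSpace α] {d : ℕ} {f g : α → Fin d → ℝ}
    (hf : UnivMeasurable f) (hg : UnivMeasurable g) : UnivMeasurable fun x => f x + g x :=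
  letI := univComp α
  Measurable.add hf hg

lemma UnivMeasurable.sub {α : Type*} [MeasurableSpace α] {d : ℕ} {f g : α → Fin d → ℝ}
    (hf : UnivMeasurable f) (hg : UnivMeasurable g) : UnivMeasurable fun x => f x - g x :=
  letI := univComp α
  Measurable.sub hf hg

lemma UnivMeasurable.neg {α : Type*} [MeasurableSpace α] {d : ℕ} {f : α → Fin d → ℝ}
    (hf : UnivMeasurable f) : UnivMeasurable fun x => -f x :=
  letI := univComp α
  Measurable.neg hf

lemma UnivMeasurable.univMeasurableSet_eq_zero {α : Type*} [MeasurableSpace α] {d : ℕ}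
    {f : α → Fin d → ℝ} (hf : UnivMeasurable f) : UnivMeasurableSet {x | f x = 0} :=
  hf (measurableSet_singleton 0)

/-- A universally measurable adapted family of positions with values in the cones `K`. -/
def IsSolventPortfolio {Ω₁ : Type*} [MeasurableSpace Ω₁] {d : ℕ}
    (K : (t : ℕ) → (Fin t → Ω₁) → Set (Fin d → ℝ)) (T : ℕ)
    (k : (t : ℕ) → (Fin t → Ω₁) → Fin d → ℝ) : Prop :=
  ∀ t, t ≤ T → UnivMeasurable (k t) ∧ ∀ ω, k t ω ∈ K t ω

/-- `F` is quasi-surely a sum of solvent positions. -/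
def IsSolventSum {Ω₁ : Type*} [MeasurableSpace Ω₁] {d : ℕ}
    (𝒬 : (t : ℕ) → (Fin t → Ω₁) → Set (ProbabilityMeasure Ω₁))
    (K : (t : ℕ) → (Fin t → Ω₁) → Set (Fin d → ℝ)) (T : ℕ) (F : (Fin T → Ω₁) → Fin d → ℝ) :
    Prop :=
  ∃ k, IsSolventPortfolio K T k ∧ QuasiSurely 𝒬 T fun ω => F ω = partialSum k T ω

section Measurable

variable {Ω₁ : Type*} [MeasurableSpace Ω₁] {T d s t : ℕ}
  {𝒬 : (t : ℕ) → (Fin t → Ω₁) → Set (ProbabilityMeasure Ω₁)}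
  {K : (t : ℕ) → (Fin t → Ω₁) → Set (Fin d → ℝ)} {F G : (Fin T → Ω₁) → Fin d → ℝ}
  {k : (t : ℕ) → (Fin t → Ω₁) → Fin d → ℝ}

lemma UnivMeasurable.partialSum (hk : ∀ s, s ≤ t → UnivMeasurable (k s)) :
    UnivMeasurable (partialSum k t) := by
  induction t with
  | zero => exact hk 0 le_rfl
  | succ t ih =>
    exact ((ih fun s hs => hk s (hs.trans t.le_succ)).comp_measurable measurable_finInit).add
      (hk (t + 1) le_rfl)

lemma IsSolventSum.congr (hF : IsSolventSum 𝒬 K T F) (h : QuasiSurely 𝒬 T fun ω => G ω = F ω) :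
    IsSolventSum 𝒬 K T G := by
  obtain ⟨k, hk, hkF⟩ := hF
  exact ⟨k, hk, (h.and hkF).mono fun ω hω => hω.1.trans hω.2⟩

/-- If only the zero position can be a selector of `A` and of `-B`, then quasi-surely `A` and
`-B` meet only in zero. -/
lemma quasiSurely_eq_zero_of_forall_selector {A B : (Fin s → Ω₁) → Set (Fin d → ℝ)}
    (hA : @IsCaratheodorySet _ (univComp _) d A) (hB : @IsCaratheodorySet _ (univComp _) d B)
    (hAc : ∀ ω, IsClosedConvexCone (A ω)) (hBc : ∀ ω, IsClosedConvexCone (B ω))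
    (h : ∀ g : (Fin s → Ω₁) → Fin d → ℝ, UnivMeasurable g → (∀ ω, g ω ∈ A ω) →
      (∀ ω, -g ω ∈ B ω) → QuasiSurely 𝒬 s fun ω => g ω = 0) :
    QuasiSurely 𝒬 s fun ω => ∀ x ∈ A ω, -x ∈ B ω → x = 0 := by
  obtain ⟨g, hgm, hg, hg0⟩ : ∃ g : (Fin s → Ω₁) → Fin d → ℝ, UnivMeasurable g ∧
      (∀ ω, (A ω ∩ {x | -x ∈ B ω} ∩ Metric.sphere 0 1).Nonempty →
        g ω ∈ A ω ∩ {x | -x ∈ B ω} ∩ Metric.sphere 0 1) ∧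
      ∀ ω, ¬ (A ω ∩ {x | -x ∈ B ω} ∩ Metric.sphere 0 1).Nonempty → g ω = 0 :=
    letI := univComp (Fin s → Ω₁)
    ((hA.inter hB.neg).inter .sphere).exists_measurable_selection
  refine (h g hgm (fun ω => ?_) fun ω => ?_).mono fun ω hω x hx hx' => ?_
  · by_cases hne : (A ω ∩ {x | -x ∈ B ω} ∩ Metric.sphere 0 1).Nonempty
    · exact (hg ω hne).1.1
    · rw [hg0 ω hne]
      exact (hAc ω).zero_mem
  · by_cases hne : (A ω ∩ {x | -x ∈ B ω} ∩ Metric.sphere 0 1).Nonempty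
    · exact (hg ω hne).1.2
    · rw [hg0 ω hne, neg_zero]
      exact (hBc ω).zero_mem
  · refine (hAc ω).eq_zero_of_inter_sphere_eq_empty (hBc ω) (fun hne => ?_) hx hx'
    have hs := (hg ω hne).2
    rw [hω] at hs
    simp at hs

end Measurable

section Polish

variable {Ω₁ : Type*} [TopologicalSpace Ω₁] [PolishSpace Ω₁] [MeasurableSpace Ω₁]
  [BorelSpace Ω₁] {T d s t : ℕ} {𝒬 : (t : ℕ) → (Fin t → Ω₁) → Set (ProbabilityMeasure Ω₁)}
  {K L : (t : ℕ) → (Fin t → Ω₁) → Set (Fin d → ℝ)} {F G : (Fin T → Ω₁) → Fin d → ℝ}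
  {k : (t : ℕ) → (Fin t → Ω₁) → Fin d → ℝ}

namespace IsSolventSum

lemma zero (hM : IsConeMarket 𝒬 K T) : IsSolventSum 𝒬 K T fun _ => 0 :=
  ⟨fun _ _ => 0, fun t ht => ⟨measurable_const.univMeasurable, fun ω => (hM.cone t ht ω).zero_mem⟩,
    .of_forall fun ω => by rw [partialSum_eq_sum]; simp⟩

lemma add (hM : IsConeMarket 𝒬 K T) (hF : IsSolventSum 𝒬 K T F) (hG : IsSolventSum 𝒬 K T G) :
    IsSolventSum 𝒬 K T fun ω => F ω + G ω := by
  obtain ⟨k, hk, hkF⟩ := hF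
  obtain ⟨l, hl, hlG⟩ := hG
  refine ⟨fun s ω => k s ω + l s ω, fun t ht => ⟨(hk t ht).1.add (hl t ht).1, fun ω =>
    (hM.cone t ht ω).add_mem ((hk t ht).2 ω) ((hl t ht).2 ω)⟩,
    (hkF.and hlG).mono fun ω hω => ?_⟩
  rw [partialSum_add, ← hω.1, ← hω.2]

lemma sum (hM : IsConeMarket 𝒬 K T) {ι : Type*} {f : ι → (Fin T → Ω₁) → Fin d → ℝ}
    (I : Finset ι) (hf : ∀ i ∈ I, IsSolventSum 𝒬 K T (f i)) :
    IsSolventSum 𝒬 K T fun ω => ∑ i ∈ I, f i ω := by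
  classical
  induction I using Finset.induction_on with
  | empty => simpa using zero hM
  | insert a I ha ih =>
    simp only [Finset.sum_insert ha]
    exact (hf a (Finset.mem_insert_self a I)).add hM
      (ih fun i hi => hf i (Finset.mem_insert_of_mem hi))

lemma of_mem (hM : IsConeMarket 𝒬 K T) (hs : s ≤ T) {f : (Fin s → Ω₁) → Fin d → ℝ}
    (hf : UnivMeasurable f) (hfK : ∀ ω, f ω ∈ K s ω) :
    IsSolventSum 𝒬 K T fun ω => f fun i => ω (Fin.castLE hs i) := by
  classical
  refine ⟨Function.update (fun _ _ => 0) s f, fun t ht => ?_, .of_forall fun ω => ?_⟩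
  · by_cases h : t = s
    · subst h
      simpa using ⟨hf, hfK⟩
    · rw [Function.update_of_ne h]
      exact ⟨measurable_const.univMeasurable, fun ω => (hM.cone t ht ω).zero_mem⟩
  · rw [partialSum_eq_sum, Finset.sum_eq_single s]
    · rw [dif_pos hs, Function.update_self]
    · intro r _ hr
      split_ifs
      · rw [Function.update_of_ne hr]
      · rfl
    · intro h
      exact absurd (Finset.mem_range.2 (Nat.lt_succ_iff.2 hs)) h

lemma of_quasiSurely_mem (hM : IsConeMarket 𝒬 K T) (hs : s ≤ T) {f : (Fin s → Ω₁) → Fin d → ℝ}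
    (hf : UnivMeasurable f) (hfK : QuasiSurely 𝒬 s fun ω => f ω ∈ K s ω) :
    IsSolventSum 𝒬 K T fun ω => f fun i => ω (Fin.castLE hs i) := by
  classical
  have hm : UnivMeasurableSet {ω | f ω ∈ K s ω} :=
    letI := univComp (Fin s → Ω₁)
    (hM.isCaratheodorySet hs).measurableSet_mem hf
  have hg : UnivMeasurable fun ω => if f ω ∈ K s ω then f ω else 0 :=
    letI := univComp (Fin s → Ω₁)
    Measurable.ite hm hf measurable_const
  refine (of_mem hM hs hg fun ω => ?_).congr ((hfK.comp_castLE hs).mono fun ω hω => ?_)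
  · split_ifs with h
    · exact h
    · exact (hM.cone s hs ω).zero_mem
  · rw [if_pos hω]

end IsSolventSum

lemma IsSolventPortfolio.eq_zero (hM : IsConeMarket 𝒬 K T) (hNA : StrictNoArbitrage 𝒬 K T)
    (hEF : EfficientFriction 𝒬 K T) (hk : IsSolventPortfolio K T k)
    (h0 : QuasiSurely 𝒬 T fun ω => partialSum k T ω = 0) (ht : t ≤ T) :
    QuasiSurely 𝒬 t fun ω => k t ω = 0 := by
  have key : ∀ t, t ≤ T → QuasiSurely 𝒬 t (fun ω => partialSum k t ω = 0) →
      QuasiSurely 𝒬 t fun ω => k t ω = 0 := by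
    intro t ht hp
    have hkm : ∀ s, s ≤ t → UnivMeasurable (k s) := fun s hs => (hk s (hs.trans ht)).1
    have hf : Attainable K t fun ω => k t ω - partialSum k t ω := by
      refine ⟨fun s ω => if hs : s < t then -k s (fun i => ω (Fin.castLE hs.le i)) else 0,
        fun s hs => ?_, fun ω => ?_⟩
      · rcases hs.lt_or_eq with h | rfl
        · exact ⟨fun ω => -k s ω, (hkm s hs).neg, fun ω => by
            simpa using (hk s (hs.trans ht)).2 ω, fun ω => dif_pos h⟩
        · exact ⟨fun _ => 0, measurable_const.univMeasurable, fun ω => by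
            simpa using (hM.cone s ht ω).zero_mem, fun ω => dif_neg (lt_irrefl s)⟩
      · simp only [partialSum_eq_sum, Finset.sum_range_succ _ t, dif_pos le_rfl, lt_irrefl,
          dif_neg not_false, add_zero]
        have hsum : ∑ s ∈ Finset.range t,
            (if hs : s < t then -k s (fun i => ω (Fin.castLE hs.le i)) else 0) =
            -∑ s ∈ Finset.range t,
              if hs : s ≤ t then k s (fun i => ω (Fin.castLE hs i)) else 0 := by
          rw [← Finset.sum_neg_distrib]
          refine Finset.sum_congr rfl fun s hs => ?_
          have hst := Finset.mem_range.1 hs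
          rw [dif_pos hst, dif_pos hst.le]
        rw [hsum]
        change k t ω - (_ + k t ω) = _
        abel
    have hmem := hNA t ht _ hf ((hkm t le_rfl).sub (.partialSum hkm))
      (hp.mono fun ω hω => by rw [hω, sub_zero]; exact (hk t ht).2 ω)
    refine ((QuasiSurely.and hmem (hEF t ht)).and hp).mono fun ω hω => ?_
    obtain ⟨⟨⟨h1, h2⟩, h3⟩, h4⟩ := hω
    rw [h4, sub_zero] at h1 h2
    exact eq_zero_of_interior_dualCone_nonempty h3 h1 h2
  refine key t ht ?_
  induction ht using Nat.decreasingInduction with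
  | self => exact h0
  | of_succ t ht ih =>
    refine QuasiSurely.of_comp_init (hM.exists_selection ht)
      (UnivMeasurable.partialSum fun s hs => (hk s (hs.trans ht.le)).1).univMeasurableSet_eq_zero
      ((ih.and (key (t + 1) ht ih)).mono fun ω hω => ?_)
    simpa [partialSum, hω.2] using hω.1

lemma IsSolventSum.eq_zero (hM : IsConeMarket 𝒬 K T) (hNA : StrictNoArbitrage 𝒬 K T)
    (hEF : EfficientFriction 𝒬 K T) (hF : IsSolventSum 𝒬 K T F)
    (hF' : IsSolventSum 𝒬 K T fun ω => -F ω) : QuasiSurely 𝒬 T fun ω => F ω = 0 := by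
  obtain ⟨k, hk, hkF⟩ := hF
  obtain ⟨l, hl, hlF⟩ := hF'
  have hkl : IsSolventPortfolio K T fun s ω => k s ω + l s ω := fun t ht =>
    ⟨(hk t ht).1.add (hl t ht).1, fun ω =>
      (hM.cone t ht ω).add_mem ((hk t ht).2 ω) ((hl t ht).2 ω)⟩
  have hsum : QuasiSurely 𝒬 T fun ω => partialSum (fun s ω => k s ω + l s ω) T ω = 0 :=
    (hkF.and hlF).mono fun ω hω => by
      rw [partialSum_add, ← hω.1, ← hω.2, add_neg_cancel]
  have hk0 : ∀ t, t ≤ T → QuasiSurely 𝒬 t fun ω => k t ω = 0 := by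
    intro t ht
    refine ((hkl.eq_zero hM hNA hEF hsum ht).and (hEF t ht)).mono fun ω hω => ?_
    refine eq_zero_of_interior_dualCone_nonempty hω.2 ((hk t ht).2 ω) ?_
    rw [neg_eq_of_add_eq_zero_right hω.1]
    exact (hl t ht).2 ω
  have hp : ∀ t, t ≤ T → QuasiSurely 𝒬 t fun ω => partialSum k t ω = 0 := by
    intro t ht
    induction t with
    | zero => exact hk0 0 ht
    | succ t ih =>
      refine ((ih (t.le_succ.trans ht)).comp_init.and (hk0 (t + 1) ht)).mono fun ω hω => ?_
      rw [partialSum, hω.1, hω.2, add_zero]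
  exact (hkF.and (hp T le_rfl)).mono fun ω hω => hω.1.trans hω.2

lemma eq_zero_of_isSolventSum_comp_castLE (hM : IsConeMarket 𝒬 K T)
    (hNA : StrictNoArbitrage 𝒬 K T) (hEF : EfficientFriction 𝒬 K T) (hs : s ≤ T)
    {f : (Fin s → Ω₁) → Fin d → ℝ} (hf : UnivMeasurable f)
    (h : IsSolventSum 𝒬 K T fun ω => f fun i => ω (Fin.castLE hs i))
    (h' : IsSolventSum 𝒬 K T fun ω => -f fun i => ω (Fin.castLE hs i)) :
    QuasiSurely 𝒬 s fun ω => f ω = 0 :=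
  .of_comp_castLE hs le_rfl (fun _ hr => hM.exists_selection hr) hf.univMeasurableSet_eq_zero
    (h.eq_zero hM hNA hEF h')

namespace IsBackwardRecursion

/-- Claims that are solvent in the modified market are sums of solvent positions of the original
market. -/
lemma isSolventSum (hL : IsBackwardRecursion 𝒬 K L T) (hM : IsConeMarket 𝒬 K T)
    (hNA : StrictNoArbitrage 𝒬 K T) (hEF : EfficientFriction 𝒬 K T) (hs : s ≤ T)
    {f : (Fin s → Ω₁) → Fin d → ℝ} (hf : UnivMeasurable f)
    (hfL : QuasiSurely 𝒬 s fun ω => f ω ∈ dualCone (L s ω)) :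
    IsSolventSum 𝒬 K T fun ω => f fun i => ω (Fin.castLE hs i) := by
  induction hs using Nat.decreasingInduction with
  | self =>
    refine .of_quasiSurely_mem hM le_rfl hf (hfL.mono fun ω hω => ?_)
    rwa [hL.terminal, (hM.cone T le_rfl ω).dualCone_dualCone] at hω
  | of_succ s hs ih =>
    have hN := hL.isCaratheodorySet_dualCone_nextSupport hM hs
    have hKc := hM.isCaratheodorySet hs.le
    have hnext : ∀ n : (Fin s → Ω₁) → Fin d → ℝ, UnivMeasurable n →
        QuasiSurely 𝒬 s (fun ω => n ω ∈ dualCone (nextSupport 𝒬 L s ω)) →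
        IsSolventSum 𝒬 K T fun ω => n fun i => ω (Fin.castLE hs.le i) := by
      intro n hn hnN
      have hn' : UnivMeasurable fun ω : Fin (s + 1) → Ω₁ => n (Fin.init ω) :=
        hn.comp_measurable measurable_finInit
      refine ih hn' (QuasiSurely.of_snoc (B := {ω | n (Fin.init ω) ∈ dualCone (L (s + 1) ω)})
        ?_ (hnN.mono fun ω hω P hP => ?_))
      · let _ := univComp (Fin (s + 1) → Ω₁)
        exact (hL.isCaratheodorySet hM hs).measurableSet_mem hn'
      · filter_upwards [hL.ae_subset_nextSupport hM hs ω hP] with x hx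
        rw [Fin.init_snoc]
        exact dualCone_anti hx hω
    have hpt : QuasiSurely 𝒬 s fun ω =>
        ∀ x ∈ K s ω, -x ∈ dualCone (nextSupport 𝒬 L s ω) → x = 0 :=
      quasiSurely_eq_zero_of_forall_selector hKc hN (hM.cone s hs.le)
        (fun ω => isClosedConvexCone_dualCone _) fun g hg hgK hgN =>
          eq_zero_of_isSolventSum_comp_castLE hM hNA hEF hs.le hg (.of_mem hM hs.le hg hgK)
            (hnext _ hg.neg (.of_forall hgN))
    obtain ⟨k, hkm, hk, hk0⟩ : ∃ k : (Fin s → Ω₁) → Fin d → ℝ, UnivMeasurable k ∧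
        (∀ ω, (K s ω ∩ {x | f ω - x ∈ dualCone (nextSupport 𝒬 L s ω)}).Nonempty →
          k ω ∈ K s ω ∩ {x | f ω - x ∈ dualCone (nextSupport 𝒬 L s ω)}) ∧
        ∀ ω, ¬ (K s ω ∩ {x | f ω - x ∈ dualCone (nextSupport 𝒬 L s ω)}).Nonempty → k ω = 0 :=
      letI := univComp (Fin s → Ω₁)
      (hKc.inter (hN.sub hf)).exists_measurable_selection
    have hdec : QuasiSurely 𝒬 s fun ω =>
        k ω ∈ K s ω ∩ {x | f ω - x ∈ dualCone (nextSupport 𝒬 L s ω)} := by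
      refine (hpt.and hfL).mono fun ω hω => hk ω ?_
      obtain ⟨h1, h2⟩ := hω
      rw [hL.step s hs] at h2
      obtain ⟨x, hx, hx'⟩ := (hM.cone s hs.le ω).exists_sub_mem_dualCone
        (hL.zero_mem_nextSupport hM hs ω) (hL.smul_mem_nextSupport hM hs ω) h1 h2
      exact ⟨x, hx, hx'⟩
    refine ((IsSolventSum.of_quasiSurely_mem hM hs.le hkm (hdec.mono fun ω hω => hω.1)).add hM
      (hnext (fun ω => f ω - k ω) (hf.sub hkm) (hdec.mono fun ω hω => hω.2))).congr
      (.of_forall fun ω => ?_)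
    exact (add_sub_cancel _ _).symm

lemma interior_nonempty (hL : IsBackwardRecursion 𝒬 K L T) (hM : IsConeMarket 𝒬 K T)
    (hNA : StrictNoArbitrage 𝒬 K T) (hEF : EfficientFriction 𝒬 K T) (hs : s ≤ T) :
    QuasiSurely 𝒬 s fun ω => (interior (L s ω)).Nonempty := by
  have hc := hL.isCaratheodorySet hM hs
  refine (quasiSurely_eq_zero_of_forall_selector hc hc
    (fun ω => isClosedConvexCone_dualCone _) (fun ω => isClosedConvexCone_dualCone _)
    fun g hg hg1 hg2 => ?_).mono fun ω hω => (hL.cone hM hs ω).interior_nonempty hω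
  exact eq_zero_of_isSolventSum_comp_castLE hM hNA hEF hs hg
    (hL.isSolventSum hM hNA hEF hs hg (.of_forall hg1))
    (hL.isSolventSum hM hNA hEF hs hg.neg (.of_forall hg2))

lemma strictNoArbitrage (hL : IsBackwardRecursion 𝒬 K L T) (hM : IsConeMarket 𝒬 K T)
    (hNA : StrictNoArbitrage 𝒬 K T) (hEF : EfficientFriction 𝒬 K T) :
    StrictNoArbitrage 𝒬 (fun t ω => dualCone (L t ω)) T := by
  rintro t ht f ⟨ξ, hξ, hfξ⟩ hf hfL
  have hneg : IsSolventSum 𝒬 K T fun ω => -f fun i => ω (Fin.castLE ht i) := by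
    refine (IsSolventSum.sum hM (f := fun s ω => -ξ s fun i => ω (Fin.castLE ht i))
      (Finset.range (t + 1)) fun s hs => ?_).congr (.of_forall fun ω => ?_)
    · have hst : s ≤ t := Nat.lt_succ_iff.1 (Finset.mem_range.1 hs)
      obtain ⟨g, hg, hgL, hgξ⟩ := hξ s hst
      simp only [hgξ]
      exact hL.isSolventSum hM hNA hEF (hst.trans ht) hg.neg (.of_forall hgL)
    · rw [hfξ, Finset.sum_neg_distrib]
  refine (eq_zero_of_isSolventSum_comp_castLE hM hNA hEF ht hf
    (hL.isSolventSum hM hNA hEF ht hf hfL) hneg).mono fun ω hω => ?_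
  have h0 := (isClosedConvexCone_dualCone (L t ω)).zero_mem
  rw [hω]
  exact ⟨h0, by simpa using h0⟩

end IsBackwardRecursion

end Polish

end

/-- Proposition 5.12. If `NAˢ(𝒫)` and efficient friction hold for the
market with solvency cones `Kₜ`, then they also hold for the modified market with solvency
cones `K̃ₜ = (K̃*ₜ)*` obtained from the backward recursion
`K̃*_T = K*_T`, `K̃*ₜ = K*ₜ ∩ cl conv (supp_{𝒫ₜ} K̃*ₜ₊₁)`; in particular
`int K̃*ₜ ≠ ∅` `𝒫`-q.s. for all `t`. -/
theorem modified_market_NAs_EF {Ω₁ : Type*} [TopologicalSpace Ω₁] [PolishSpace Ω₁]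
    [MeasurableSpace Ω₁] [BorelSpace Ω₁] (T d : ℕ)
    (𝒬 : (t : ℕ) → (Fin t → Ω₁) → Set (ProbabilityMeasure Ω₁))
    (h𝒬ne : ∀ t, t < T → ∀ ω, (𝒬 t ω).Nonempty)
    (h𝒬conv : ∀ t, t < T → ∀ ω, ConvexProb (𝒬 t ω))
    (h𝒬graph : ∀ t, t < T →
      AnalyticSet {p : (Fin t → Ω₁) × ProbabilityMeasure Ω₁ | p.2 ∈ 𝒬 t p.1})
    (K : (t : ℕ) → (Fin t → Ω₁) → Set (Fin d → ℝ))
    (hKcl : ∀ t, t ≤ T → ∀ ω, IsClosed (K t ω))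
    (hKconv : ∀ t, t ≤ T → ∀ ω, Convex ℝ (K t ω))
    (hKcone : ∀ t, t ≤ T → ∀ ω, ∀ c : ℝ, 0 ≤ c → ∀ x ∈ K t ω, c • x ∈ K t ω)
    (hKorth : ∀ t, t ≤ T → ∀ ω, {x : Fin d → ℝ | ∀ i, 0 ≤ x i} ⊆ K t ω)
    (hKgraph : ∀ t, t ≤ T →
      AnalyticSet {p : (Fin t → Ω₁) × (Fin d → ℝ) | p.2 ∈ dualCone (K t p.1)})
    (Ktstar : (t : ℕ) → (Fin t → Ω₁) → Set (Fin d → ℝ))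
    (hT : Ktstar T = fun ω => dualCone (K T ω))
    (hrec : ∀ t, t < T → ∀ ω, Ktstar t ω = dualCone (K t ω) ∩
      closure (convexHull ℝ
        (svSupport (𝒬 t ω) (fun ω' => Ktstar (t + 1) (Fin.snoc ω ω')))))
    (hNAs : StrictNoArbitrage 𝒬 K T)
    (hEF : EfficientFriction 𝒬 K T) :
    StrictNoArbitrage 𝒬 (fun t ω => dualCone (Ktstar t ω)) T ∧
    EfficientFriction 𝒬 (fun t ω => dualCone (Ktstar t ω)) T ∧
    ∀ t, t ≤ T → ∀ μ ∈ ProdSet 𝒬 t, ∀ᵐ ω ∂μ, (interior (Ktstar t ω)).Nonempty := by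
  have hM : IsConeMarket 𝒬 K T := ⟨h𝒬ne, h𝒬graph, fun t ht ω =>
    ⟨hKcl t ht ω, hKconv t ht ω, hKorth t ht ω fun _ => le_rfl, hKcone t ht ω⟩, hKgraph⟩
  have hL : IsBackwardRecursion 𝒬 K Ktstar T := ⟨fun ω => congrFun hT ω, hrec⟩
  have hint : ∀ t, t ≤ T → QuasiSurely 𝒬 t fun ω => (interior (Ktstar t ω)).Nonempty :=
    fun t ht => hL.interior_nonempty hM hNAs hEF ht
  exact ⟨hL.strictNoArbitrage hM hNAs hEF, fun t ht => (hint t ht).mono fun ω hω =>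
    hω.mono (interior_mono subset_dualCone_dualCone), hint⟩
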